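/- arXiv:2104.11429 — 4 statements merged into one kernel-verified Lean document; each statement's English description precedes it below -/
import Mathlib

section
/- For every x in the topological boundary ∂Ω there exists a Lipschitz path from q to x of length exactly λ d(x,p) lying entirely in M∖Ω. Consequently, every point of M∖Ω can be joined to q by a Lipschitz path of finite length in M∖Ω; in particular, M∖Ω is path-connected. -/
/-!
Formalization framework for "growth competitions" (after the paper's
Section 2), at the metric-space level.

Since Mathlib does not yet have Riemannian metrics, a complete Riemannian
manifold is represented by a proper (hence complete; Hopf-Rinow) metric
space whose distance is the induced length (intrinsic) metric, and
spherical symmetry about `p` with warping function `G` is expressed through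
global geodesic polar normal coordinates `Φ : ℝⁿ ≃ M` with `Φ 0 = p` and
`dist (Φ x) p = ‖x‖`, in which the Riemannian distance is the infimum of
lengths of Lipschitz curves measured in the warped metric
`g = dr² + G(r)² dθ²`.
-/

open Set Metric Filter MeasureTheory InnerProductGeometry NNReal ENNReal
open scoped RealInnerProductSpace Classical

noncomputable section

namespace GrowthComp

variable {M : Type*} [MetricSpace M]

/-- Length of the path `γ : ℝ → M` over the time interval `[0, T]`
(the total variation of `γ` on `[0, T]`, valued in `ℝ≥0∞`). -/
def pathLength (γ : ℝ → M) (T : ℝ) : ℝ≥0∞ := eVariationOn γ (Set.Icc 0 T)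

/-- The intrinsic metric `d_S` of `M ∖ S`: the infimum of lengths of Lipschitz
paths from `x` to `y` avoiding `S` (with `sInf ∅ = ∞`). -/
def dCompl (S : Set M) (x y : M) : ℝ≥0∞ :=
  sInf {L : ℝ≥0∞ | ∃ (T : ℝ) (γ : ℝ → M), 0 ≤ T ∧ γ 0 = x ∧ γ T = y ∧
    (∃ K : ℝ≥0, LipschitzOnWith K γ (Set.Icc 0 T)) ∧
    (∀ t ∈ Set.Icc 0 T, γ t ∉ S) ∧ L = pathLength γ T}

/-- The distance of `M` is the induced length metric (true for every
complete Riemannian manifold). -/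
def IsLengthSpace (M : Type*) [MetricSpace M] : Prop :=
  ∀ x y : M, ENNReal.ofReal (dist x y) = dCompl (∅ : Set M) x y

/-- A path `γ : [0, T] → M` *avoids* the (time-indexed) family `B`:
it starts at `q`, is `λ`-Lipschitz, and `γ s ∉ B s` for all `s ∈ [0, T]`. -/
def AvoidsB (q : M) (lam : ℝ) (B : ℝ → Set M) (T : ℝ) (γ : ℝ → M) : Prop :=
  γ 0 = q ∧ LipschitzOnWith (Real.toNNReal lam) γ (Set.Icc 0 T) ∧
    ∀ s ∈ Set.Icc 0 T, γ s ∉ B s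

/-- A path `η : [0, T] → M` *avoids* the family `A`:
it starts at `p`, is `1`-Lipschitz, and `η s ∉ A s` for all `s ∈ [0, T]`. -/
def AvoidsA (p : M) (A : ℝ → Set M) (T : ℝ) (η : ℝ → M) : Prop :=
  η 0 = p ∧ LipschitzOnWith 1 η (Set.Icc 0 T) ∧ ∀ s ∈ Set.Icc 0 T, η s ∉ A s

/-- `{A_t, B_t}_{t ≥ 0}` is a *growth competition* between `p` and `q` with
speed ratio `λ`: both families are increasing, `A 0 = {q}`, `B 0 = {p}`, and
for `t > 0`, `A t` is the union of `γ([0,t])` over paths `γ` avoiding `B`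
and `B t` is the union of `η([0,t))` over paths `η` avoiding `A`. -/
structure IsGrowthCompetition (p q : M) (lam : ℝ) (A B : ℝ → Set M) : Prop where
  monoA : ∀ ⦃t₁ t₂ : ℝ⦄, 0 ≤ t₁ → t₁ ≤ t₂ → A t₁ ⊆ A t₂
  monoB : ∀ ⦃t₁ t₂ : ℝ⦄, 0 ≤ t₁ → t₁ ≤ t₂ → B t₁ ⊆ B t₂
  A_zero : A 0 = {q}
  B_zero : B 0 = {p}
  A_eq : ∀ t : ℝ, 0 < t →
    A t = {x | ∃ γ : ℝ → M, AvoidsB q lam B t γ ∧ x ∈ γ '' Set.Icc 0 t}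
  B_eq : ∀ t : ℝ, 0 < t →
    B t = {x | ∃ η : ℝ → M, AvoidsA p A t η ∧ x ∈ η '' Set.Ico 0 t}

/-- `A_∞ = ⋃_{t ≥ 0} A_t`. -/
def Ainfty (A : ℝ → Set M) : Set M := ⋃ t ∈ Set.Ici (0 : ℝ), A t

/-- `B_∞ = ⋃_{t ≥ 0} B_t`. -/
def Binfty (B : ℝ → Set M) : Set M := ⋃ t ∈ Set.Ici (0 : ℝ), B t

/-- The recursively defined sets `Ω_n`:
`Ω_0 = ∅`, `Ω_{n+1} = Ω_n ∪ {x ∈ M ∖ Ω_n | d_{Ω_n}(x, q) > λ d(x, p)}`. -/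
def OmegaSeq (p q : M) (lam : ℝ) : ℕ → Set M
  | 0 => ∅
  | n + 1 => OmegaSeq p q lam n ∪
      {x | x ∉ OmegaSeq p q lam n ∧
        ENNReal.ofReal (lam * dist x p) < dCompl (OmegaSeq p q lam n) x q}

/-- `Ω = ⋃_{n ≥ 1} Ω_n`. -/
def Omega (p q : M) (lam : ℝ) : Set M := ⋃ n : ℕ, OmegaSeq p q lam (n + 1)

/-- `γ` is a unit-speed minimizing geodesic from `x` to `y`, parametrized on
`[0, dist x y]`. -/
def IsMinGeodesicFromTo (γ : ℝ → M) (x y : M) : Prop :=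
  γ 0 = x ∧ γ (dist x y) = y ∧
    ∀ s ∈ Set.Icc (0 : ℝ) (dist x y), ∀ t ∈ Set.Icc (0 : ℝ) (dist x y),
      dist (γ s) (γ t) = |s - t|

/-- `S` is star-shaped about `p`: every minimizing geodesic from `p` to a
point of `S` lies inside `S`. -/
def StarShapedAbout (p : M) (S : Set M) : Prop :=
  ∀ x ∈ S, ∀ γ : ℝ → M, IsMinGeodesicFromTo γ p x →
    ∀ t ∈ Set.Icc (0 : ℝ) (dist p x), γ t ∈ S

/-- `x` is *visible* from `q` through the obstacle `S`: no minimizing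
geodesic joining `q` and `x` intersects `S`.  (On a nonpositively curved
simply connected manifold minimizing geodesics are unique, so this matches
"the minimizing geodesic joining `q` and `x` does not intersect `S`".) -/
def VisibleThrough (S : Set M) (q x : M) : Prop :=
  ∀ γ : ℝ → M, IsMinGeodesicFromTo γ q x →
    ∀ t ∈ Set.Icc (0 : ℝ) (dist q x), γ t ∉ S

/-! ### Spherically symmetric manifolds, via polar normal coordinates -/

/-- Euclidean `n`-space, the model space for polar normal coordinates. -/
abbrev Euc (n : ℕ) : Type := EuclideanSpace ℝ (Fin n)

/-- The norm of the tangent vector `v` at the point `x ∈ ℝⁿ ∖ {0}` in the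
spherically symmetric (warped product) metric `g = dr² + G(r)² dθ²`:
`g_x(v,v) = ⟨v, x̂⟩² + (G(‖x‖)²/‖x‖²) (‖v‖² − ⟨v, x̂⟩²)`. -/
def warpNorm {n : ℕ} (G : ℝ → ℝ) (x v : Euc n) : ℝ :=
  if x = 0 then ‖v‖
  else Real.sqrt (⟪v, ‖x‖⁻¹ • x⟫ ^ 2 +
    (G ‖x‖ / ‖x‖) ^ 2 * (‖v‖ ^ 2 - ⟪v, ‖x‖⁻¹ • x⟫ ^ 2))

/-- The length of a (Lipschitz, hence a.e. differentiable) curve `c` on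
`[0, T]` in the warped metric `dr² + G(r)² dθ²`. -/
def warpLength {n : ℕ} (G : ℝ → ℝ) (c : ℝ → Euc n) (T : ℝ) : ℝ≥0∞ :=
  ∫⁻ t in Set.Icc (0 : ℝ) T, ENNReal.ofReal (warpNorm G (c t) (deriv c t))

/-- `G` is an admissible warping function: positive and smooth on `(0,∞)`,
with `G(r) → 0` and `G(r)/r → 1` as `r → 0⁺`. -/
def IsWarping (G : ℝ → ℝ) : Prop :=
  (∀ r : ℝ, 0 < r → 0 < G r) ∧ ContDiffOn ℝ (⊤ : ℕ∞) G (Set.Ioi 0) ∧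
    Tendsto G (nhdsWithin 0 (Set.Ioi 0)) (nhds 0) ∧
    Tendsto (fun r => G r / r) (nhdsWithin 0 (Set.Ioi 0)) (nhds 1)

/-- `Φ : ℝⁿ ≃ M` realizes `M` as spherically symmetric about `p` with
warping function `G`: `Φ` is a global geodesic polar normal coordinate
chart — `Φ 0 = p` and the radial coordinate is the distance to `p` — and
the Riemannian distance of `M` is the infimum of warped lengths of
Lipschitz curves computed in the chart. -/
def IsSphericallySymmetric {n : ℕ} (p : M) (G : ℝ → ℝ) (Φ : Euc n ≃ M) : Prop :=
  IsWarping G ∧ Φ 0 = p ∧ (∀ x : Euc n, dist (Φ x) p = ‖x‖) ∧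
    ∀ x y : Euc n, ENNReal.ofReal (dist (Φ x) (Φ y)) =
      sInf {L : ℝ≥0∞ | ∃ (T : ℝ) (c : ℝ → Euc n), 0 ≤ T ∧ c 0 = x ∧ c T = y ∧
        (∃ K : ℝ≥0, LipschitzOnWith K c (Set.Icc 0 T)) ∧ L = warpLength G c T}

/-- The angular polar coordinate `θ(x) ∈ S_pM ≅ S^{n-1}` of a point
`x ≠ p`, read off through the polar chart `Φ`. -/
def polarTheta {n : ℕ} {M : Type*} [MetricSpace M] (Φ : Euc n ≃ M) (x : M) : Euc n :=
  ‖Φ.symm x‖⁻¹ • Φ.symm x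

/-- Nonpositive sectional curvature for the spherically symmetric metric
`dr² + G(r)² dθ²`: the radial sectional curvature is `−G''/G ≤ 0`,
i.e. `G` is convex, and the tangential one is `(1 − G'²)/G² ≤ 0`,
i.e. `G' ≥ 1`. -/
def NonposCurvWarping (G : ℝ → ℝ) : Prop :=
  ConvexOn ℝ (Set.Ioi 0) G ∧ ∀ r : ℝ, 0 < r → 1 ≤ deriv G r

/-- `∫₁^∞ dr / G(r) = ∞`.  For a surface of revolution this is, by a theorem
of Milnor cited in the paper, equivalent to parabolicity, i.e. conformal
equivalence to the Euclidean plane. -/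
def ParabolicWarping (G : ℝ → ℝ) : Prop :=
  ∫⁻ r in Set.Ici (1 : ℝ), ENNReal.ofReal ((G r)⁻¹) = ⊤

/-- `∫₁^∞ dr / G(r) < ∞`.  For a surface of revolution this is, by a theorem
of Milnor cited in the paper, equivalent to hyperbolicity, i.e. conformal
equivalence to the hyperbolic plane. -/
def HyperbolicWarping (G : ℝ → ℝ) : Prop :=
  ∫⁻ r in Set.Ici (1 : ℝ), ENNReal.ofReal ((G r)⁻¹) < ⊤

/-- `y` is reached from `x` at time `L` by a `1`-Lipschitz path avoiding `S`. -/
def Reaches (S : Set M) (x y : M) (L : ℝ) : Prop :=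
  ∃ γ : ℝ → M, LipschitzWith 1 γ ∧ γ 0 = x ∧ γ L = y ∧ ∀ t, γ t ∉ S

lemma Reaches.mono {S S' : Set M} {x y : M} {L : ℝ} (hS : S' ⊆ S) (h : Reaches S x y L) :
    Reaches S' x y L := by
  obtain ⟨γ, h1, h2, h3, h4⟩ := h
  exact ⟨γ, h1, h2, h3, fun t ht => h4 t (hS ht)⟩

lemma Reaches.notMem {S : Set M} {x y : M} {L : ℝ} (h : Reaches S x y L) : y ∉ S := by
  obtain ⟨γ, -, -, rfl, h⟩ := h
  exact h L

lemma Reaches.symm {S : Set M} {x y : M} {L : ℝ} (h : Reaches S x y L) : Reaches S y x L := by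
  obtain ⟨γ, h1, rfl, rfl, h4⟩ := h
  refine ⟨fun t => γ (L - t), LipschitzWith.of_dist_le_mul fun s t => ?_, by simp, by simp,
    fun t => h4 _⟩
  simpa only [dist_sub_left] using h1.dist_le_mul (L - s) (L - t)

/-- Clamping time to `[0, L]` extends a path defined on `[0, L]` to all times. -/
lemma reaches_of_lipschitzOnWith {S : Set M} {γ : ℝ → M} {L : ℝ} (hL : 0 ≤ L)
    (hγ : LipschitzOnWith 1 γ (Icc 0 L)) (hS : ∀ t ∈ Icc 0 L, γ t ∉ S) :
    Reaches S (γ 0) (γ L) L := by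
  refine ⟨fun t => γ (projIcc 0 L hL t), LipschitzWith.of_dist_le_mul fun s t => ?_, ?_, ?_,
    fun t => hS _ (projIcc 0 L hL t).2⟩
  · refine (hγ.dist_le_mul _ (projIcc 0 L hL s).2 _ (projIcc 0 L hL t).2).trans ?_
    simpa [Subtype.dist_eq] using (LipschitzWith.projIcc hL).dist_le_mul s t
  · simp
  · simp

lemma Reaches.trans {S : Set M} {x y z : M} {L L' : ℝ} (hL : 0 ≤ L) (hL' : 0 ≤ L')
    (h : Reaches S x y L) (h' : Reaches S y z L') : Reaches S x z (L + L') := by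
  obtain ⟨γ, h1, rfl, rfl, h4⟩ := h
  obtain ⟨η, k1, k2, rfl, k4⟩ := h'
  have key : ∀ s t, s ≤ t → dist (if s ≤ L then γ s else η (s - L))
      (if t ≤ L then γ t else η (t - L)) ≤ t - s := by
    intro s t hst
    split_ifs with hs ht ht
    · simpa [Real.dist_eq, abs_of_nonpos (sub_nonpos.2 hst)] using h1.dist_le_mul s t
    · have a := h1.dist_le_mul s L
      have b := k1.dist_le_mul 0 (t - L)
      push Not at ht
      rw [k2] at b
      simp only [NNReal.coe_one, one_mul, Real.dist_eq, abs_of_nonpos (sub_nonpos.2 hs)] at a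
      simp only [NNReal.coe_one, one_mul, Real.dist_eq, zero_sub, abs_neg,
        abs_of_pos (sub_pos.2 ht)] at b
      linarith [dist_triangle (γ s) (γ L) (η (t - L))]
    · linarith
    · simpa [Real.dist_eq, abs_of_nonpos (sub_nonpos.2 hst)] using k1.dist_le_mul (s - L) (t - L)
  refine ⟨fun t => if t ≤ L then γ t else η (t - L), LipschitzWith.of_dist_le_mul fun s t => ?_,
    by simp [hL], ?_, fun t => ?_⟩
  · rcases le_total s t with hst | hst
    · simpa [Real.dist_eq, abs_of_nonpos (sub_nonpos.2 hst)] using key s t hst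
    · rw [dist_comm]
      simpa [Real.dist_eq, abs_of_nonneg (sub_nonneg.2 hst)] using key t s hst
  · rcases hL'.eq_or_lt with rfl | h
    · simp [k2]
    · simp [not_le.2 h]
  · dsimp only
    split_ifs
    exacts [h4 _, k4 _]

lemma pathLength_le_of_lipschitzWith {γ : ℝ → M} (hγ : LipschitzWith 1 γ) (L : ℝ) :
    pathLength γ L ≤ ENNReal.ofReal L := by
  simpa [pathLength] using (hγ.lipschitzOnWith (s := univ)).comp_eVariationOn_le
    (g := id) (s := Icc 0 L) (mapsTo_univ _ _)

lemma Reaches.dCompl_le {S : Set M} {x y : M} {L : ℝ} (hL : 0 ≤ L) (h : Reaches S x y L) :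
    dCompl S x y ≤ ENNReal.ofReal L := by
  obtain ⟨γ, h1, h2, h3, h4⟩ := h
  refine le_trans (sInf_le ?_) (pathLength_le_of_lipschitzWith h1 L)
  exact ⟨L, γ, hL, h2, h3, ⟨1, h1.lipschitzOnWith⟩, fun t _ => h4 t, rfl⟩

/-- A Lipschitz path of length at most `L` can be reparametrized with speed at most one on
`[0, L]`. -/
lemma reaches_of_pathLength_le {S : Set M} {γ : ℝ → M} {T L : ℝ} {K : ℝ≥0} (hT : 0 ≤ T)
    (hL : 0 ≤ L) (hγ : LipschitzOnWith K γ (Icc 0 T)) (hS : ∀ t ∈ Icc 0 T, γ t ∉ S)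
    (hlen : pathLength γ T ≤ ENNReal.ofReal L) : Reaches S (γ 0) (γ T) L := by
  have hsub : ∀ {a b : ℝ}, 0 ≤ a → b ≤ T → Icc a b ⊆ Icc 0 T := fun ha hb => Icc_subset_Icc ha hb
  have hfin : ∀ {a b : ℝ}, 0 ≤ a → b ≤ T → eVariationOn γ (Icc a b) ≠ ∞ := fun ha hb =>
    ne_top_of_le_ne_top (ne_top_of_le_ne_top ENNReal.ofReal_ne_top hlen)
      (eVariationOn.mono γ (hsub ha hb))
  set σ : ℝ → ℝ := fun t => (eVariationOn γ (Icc 0 t)).toReal with hσ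
  have hadd : ∀ {a b : ℝ}, 0 ≤ a → a ≤ b → b ≤ T →
      σ b - σ a = (eVariationOn γ (Icc a b)).toReal := by
    intro a b ha hab hb
    have h := eVariationOn.Icc_add_Icc γ (s := univ) ha hab (mem_univ a)
    simp only [univ_inter] at h
    simp only [hσ]
    rw [← h, ENNReal.toReal_add (hfin le_rfl (hab.trans hb)) (hfin ha hb)]
    ring
  have hdist : ∀ {a b : ℝ}, 0 ≤ a → a ≤ b → b ≤ T → dist (γ a) (γ b) ≤ σ b - σ a := by
    intro a b ha hab hb
    rw [hadd ha hab hb, dist_edist]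
    exact ENNReal.toReal_mono (hfin ha hb)
      (eVariationOn.edist_le γ (left_mem_Icc.2 hab) (right_mem_Icc.2 hab))
  have hdist' : ∀ a ∈ Icc 0 T, ∀ b ∈ Icc 0 T, dist (γ a) (γ b) ≤ |σ a - σ b| := by
    intro a ha b hb
    rcases le_total a b with h | h
    · rw [abs_sub_comm]
      exact (hdist ha.1 h hb.2).trans (le_abs_self _)
    · rw [dist_comm]
      exact (hdist hb.1 h ha.2).trans (le_abs_self _)
  have hlip : ∀ {a b : ℝ}, 0 ≤ a → a ≤ b → b ≤ T → |σ b - σ a| ≤ K * (b - a) := by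
    intro a b ha hab hb
    rw [hadd ha hab hb, abs_of_nonneg ENNReal.toReal_nonneg]
    have h : eVariationOn γ (Icc a b) ≤ K * ENNReal.ofReal (b - a) := by
      simpa using hγ.comp_eVariationOn_le (g := id) (s := Icc a b) (hsub ha hb)
    have h' := ENNReal.toReal_mono (by finiteness) h
    simpa [ENNReal.toReal_ofReal (sub_nonneg.2 hab)] using h'
  have hcont : ContinuousOn σ (Icc 0 T) := by
    refine LipschitzOnWith.continuousOn (K := K) (LipschitzOnWith.of_dist_le_mul ?_)
    intro a ha b hb
    rw [Real.dist_eq, Real.dist_eq]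
    rcases le_total a b with h | h
    · rw [abs_sub_comm, abs_sub_comm a b, abs_of_nonneg (sub_nonneg.2 h)]
      exact hlip ha.1 h hb.2
    · rw [abs_of_nonneg (sub_nonneg.2 h)]
      exact hlip hb.1 h ha.2
  have hσ0 : σ 0 = 0 := by simp [hσ, eVariationOn.subsingleton]
  have hσT : 0 ≤ σ T := ENNReal.toReal_nonneg
  have hσL : σ T ≤ L := by
    have h := ENNReal.toReal_mono ENNReal.ofReal_ne_top hlen
    rwa [ENNReal.toReal_ofReal hL] at h
  have hex : ∀ r : ℝ, ∃ t ∈ Icc 0 T, σ t = projIcc 0 (σ T) hσT r := by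
    intro r
    have h := intermediate_value_Icc hT hcont
    rw [hσ0] at h
    exact h (projIcc 0 (σ T) hσT r).2
  choose τ hτ hστ using hex
  refine ⟨fun r => γ (τ r), LipschitzWith.of_dist_le_mul fun r s => ?_, ?_, ?_,
    fun r => hS _ (hτ r)⟩
  · refine (hdist' _ (hτ r) _ (hτ s)).trans ?_
    rw [hστ, hστ]
    exact (LipschitzWith.projIcc hσT).dist_le_mul r s
  · refine dist_le_zero.1 ((hdist' _ (hτ 0) 0 ⟨le_rfl, hT⟩).trans ?_)
    simp [hστ, hσ0]
  · refine dist_le_zero.1 ((hdist' _ (hτ L) T ⟨hT, le_rfl⟩).trans ?_)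
    simp [hστ, projIcc_of_right_le hσT hσL]

lemma reaches_of_dCompl_lt {S : Set M} {x y : M} {L : ℝ}
    (h : dCompl S x y < ENNReal.ofReal L) : Reaches S x y L := by
  obtain ⟨_, ⟨T, γ, hT, rfl, rfl, ⟨K, hK⟩, hS, rfl⟩, hlt⟩ := sInf_lt_iff.1 h
  have hL : 0 < L := ENNReal.ofReal_pos.1 (bot_le.trans_lt hlt)
  exact reaches_of_pathLength_le hT hL.le hK hS hlt.le

lemma dCompl_eq_top_of_mem {S : Set M} {x : M} (hx : x ∈ S) (y : M) : dCompl S x y = ∞ := by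
  refine sInf_eq_top.2 ?_
  rintro _ ⟨T, γ, hT, rfl, -, -, hS, -⟩
  exact absurd hx (hS 0 ⟨le_rfl, hT⟩)

/-- Compactness of `1`-Lipschitz paths avoiding an increasing sequence of open sets. -/
lemma reaches_iUnion_of_tendsto [ProperSpace M] {S : ℕ → Set M} (hmono : Monotone S)
    (hopen : ∀ n, IsOpen (S n)) {x y : M} {ys : ℕ → M} {L : ℝ} {Ls : ℕ → ℝ}
    (hy : Tendsto ys atTop (nhds y)) (hL : Tendsto Ls atTop (nhds L))
    (h : ∀ n, Reaches (S n) x (ys n) (Ls n)) : Reaches (⋃ n, S n) x y L := by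
  choose γ h1 h2 h3 h4 using h
  let U : Ultrafilter ℕ := hyperfilter ℕ
  have hU : (U : Filter ℕ) ≤ atTop := Nat.hyperfilter_le_atTop
  have hlim : ∀ t, ∃ z, Tendsto (fun n => γ n t) U (nhds z) := by
    intro t
    have hb : ∀ n, γ n t ∈ closedBall x |t| := by
      intro n
      have h := (h1 n).dist_le_mul t 0
      simpa [h2] using h
    obtain ⟨z, -, hz⟩ := (isCompact_closedBall x |t|).ultrafilter_le_nhds
      (U.map fun n => γ n t) (le_principal_iff.2 (Eventually.of_forall (f := (U : Filter ℕ)) hb))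
    exact ⟨z, hz⟩
  choose η hη using hlim
  refine ⟨η, LipschitzWith.of_dist_le_mul fun s t => ?_, ?_, ?_, fun t ht => ?_⟩
  · exact le_of_tendsto ((hη s).dist (hη t)) (Eventually.of_forall fun n => (h1 n).dist_le_mul s t)
  · refine tendsto_nhds_unique (hη 0) ?_
    simp only [h2]
    exact tendsto_const_nhds
  · refine tendsto_nhds_unique (hη L) ((hy.mono_left hU).congr_dist ?_)
    have hd : Tendsto (fun n => dist (Ls n) L) U (nhds 0) :=
      (tendsto_iff_dist_tendsto_zero.1 hL).mono_left hU
    refine squeeze_zero (fun n => dist_nonneg) (fun n => ?_) hd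
    rw [← h3 n]
    simpa using (h1 n).dist_le_mul (Ls n) L
  · obtain ⟨m, hm⟩ := mem_iUnion.1 ht
    have hev : ∀ᶠ n in (U : Filter ℕ), m ≤ n := hU (eventually_ge_atTop m)
    obtain ⟨n, hn, hmn⟩ := (((hη t).eventually ((hopen m).mem_nhds hm)).and hev).exists
    exact h4 n t (hmono hmn hn)

lemma Reaches.joinedIn {S : Set M} {x y : M} {L : ℝ} (h : Reaches S x y L) :
    JoinedIn Sᶜ x y := by
  obtain ⟨γ, h1, h2, h3, h4⟩ := h
  have := h1.continuous
  refine JoinedIn.ofLine (f := fun t => γ (L * t)) (by fun_prop) (by simpa) (by simpa) ?_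
  rintro _ ⟨t, -, rfl⟩
  exact h4 _

lemma mem_OmegaSeq_succ {p q : M} {lam : ℝ} {n : ℕ} {x : M} :
    x ∈ OmegaSeq p q lam (n + 1) ↔
      ENNReal.ofReal (lam * dist x p) < dCompl (OmegaSeq p q lam n) x q := by
  by_cases hx : x ∈ OmegaSeq p q lam n
  · simp [OmegaSeq, hx, dCompl_eq_top_of_mem]
  · simp [OmegaSeq, hx]

lemma OmegaSeq_mono (p q : M) (lam : ℝ) : Monotone (OmegaSeq p q lam) :=
  monotone_nat_of_le_succ fun _ => subset_union_left

lemma Omega_eq_iUnion (p q : M) (lam : ℝ) : Omega p q lam = ⋃ n, OmegaSeq p q lam n :=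
  subset_antisymm (iUnion_subset fun n => subset_iUnion (OmegaSeq p q lam) (n + 1))
    (iUnion_mono fun n => OmegaSeq_mono p q lam n.le_succ)

lemma OmegaSeq_subset_Omega (p q : M) (lam : ℝ) (n : ℕ) : OmegaSeq p q lam n ⊆ Omega p q lam :=
  Omega_eq_iUnion p q lam ▸ subset_iUnion _ n

/-- Points outside `Ω_{n+1}` are reached avoiding `Ω_n` in any time exceeding `λ d(x, p)`. -/
lemma reaches_of_notMem_OmegaSeq_succ {p q x : M} {lam L : ℝ} (hlam : 0 ≤ lam) {n : ℕ}
    (hx : x ∉ OmegaSeq p q lam (n + 1)) (hL : lam * dist x p < L) :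
    Reaches (OmegaSeq p q lam n) q x L := by
  rw [mem_OmegaSeq_succ, not_lt] at hx
  have h0 : 0 ≤ lam * dist x p := by positivity
  exact (reaches_of_dCompl_lt
    (hx.trans_lt ((ENNReal.ofReal_lt_ofReal_iff (h0.trans_lt hL)).2 hL))).symm

lemma Reaches.notMem_OmegaSeq_succ {p q x : M} {lam L : ℝ} {n : ℕ} (hL0 : 0 ≤ L)
    (h : Reaches (OmegaSeq p q lam n) q x L) (hL : L ≤ lam * dist x p) :
    x ∉ OmegaSeq p q lam (n + 1) := by
  rw [mem_OmegaSeq_succ, not_lt]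
  exact (h.symm.dCompl_le hL0).trans (ENNReal.ofReal_le_ofReal hL)

lemma isOpen_OmegaSeq [ProperSpace M] (p q : M) {lam : ℝ} (hlam : 0 ≤ lam) (n : ℕ) :
    IsOpen (OmegaSeq p q lam n) := by
  induction n with
  | zero => exact isOpen_empty
  | succ n ih =>
    rw [← isClosed_compl_iff]
    refine IsSeqClosed.isClosed fun ys y hys hy => ?_
    have hL : Tendsto (fun k : ℕ => lam * dist (ys k) p + 1 / ((k : ℝ) + 1)) atTop
        (nhds (lam * dist y p)) := by
      simpa using ((hy.dist tendsto_const_nhds).const_mul lam).add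
        (tendsto_one_div_add_atTop_nhds_zero_nat (𝕜 := ℝ))
    have h := reaches_iUnion_of_tendsto (S := fun _ => OmegaSeq p q lam n) monotone_const
      (fun _ => ih) hy hL fun k => reaches_of_notMem_OmegaSeq_succ hlam (hys k)
        (lt_add_of_pos_right _ (by positivity))
    rw [iUnion_const] at h
    exact h.notMem_OmegaSeq_succ (by positivity) le_rfl

lemma isOpen_Omega [ProperSpace M] (p q : M) {lam : ℝ} (hlam : 0 ≤ lam) :
    IsOpen (Omega p q lam) :=
  isOpen_iUnion fun n => isOpen_OmegaSeq p q hlam (n + 1)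

lemma reaches_of_notMem_Omega [ProperSpace M] {p q x : M} {lam : ℝ} (hlam : 0 ≤ lam)
    (hx : x ∉ Omega p q lam) : Reaches (Omega p q lam) q x (lam * dist x p) := by
  have hL : Tendsto (fun k : ℕ => lam * dist x p + 1 / ((k : ℝ) + 1)) atTop
      (nhds (lam * dist x p)) := by
    simpa using (tendsto_const_nhds (x := lam * dist x p)).add
      (tendsto_one_div_add_atTop_nhds_zero_nat (𝕜 := ℝ))
  rw [Omega_eq_iUnion]
  exact reaches_iUnion_of_tendsto (OmegaSeq_mono p q lam) (isOpen_OmegaSeq p q hlam)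
    tendsto_const_nhds hL fun k => reaches_of_notMem_OmegaSeq_succ hlam
      (fun h => hx (OmegaSeq_subset_Omega p q lam _ h)) (lt_add_of_pos_right _ (by positivity))

/-- In a length space, points of a ball are joined to its center inside the ball. -/
lemma reaches_of_disjoint_ball (hM : IsLengthSpace M) {S : Set M} {x y : M} {r : ℝ}
    (hS : Disjoint S (ball x r)) (hy : dist x y < r) : ∃ L, 0 ≤ L ∧ L < r ∧ Reaches S x y L := by
  obtain ⟨L, hxL, hLr⟩ := exists_between hy
  have hL : 0 < L := dist_nonneg.trans_lt hxL
  obtain ⟨γ, h1, rfl, rfl, -⟩ := reaches_of_dCompl_lt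
    (hM x y ▸ (ENNReal.ofReal_lt_ofReal_iff hL).2 hxL)
  refine ⟨L, hL.le, hLr, reaches_of_lipschitzOnWith hL.le h1.lipschitzOnWith fun t ht hmem => ?_⟩
  refine disjoint_left.1 hS hmem (mem_ball.2 ?_)
  have h := h1.dist_le_mul t 0
  simp only [NNReal.coe_one, one_mul, dist_zero_right, Real.norm_eq_abs, abs_of_nonneg ht.1] at h
  linarith [ht.2]

/-- A point reached avoiding `Ω` strictly before time `λ d(x, p)` is not a boundary point. -/
lemma Reaches.notMem_frontier_Omega (hM : IsLengthSpace M) {p q x : M} {lam L : ℝ}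
    (hlam : 0 ≤ lam) (hL0 : 0 ≤ L) (h : Reaches (Omega p q lam) q x L)
    (hL : L < lam * dist x p) : x ∉ frontier (Omega p q lam) := by
  set r : ℝ := (lam * dist x p - L) / (1 + lam) with hr
  have hr0 : 0 < r := div_pos (sub_pos.2 hL) (by positivity)
  have hrL : L + r = lam * (dist x p - r) := by
    have : 1 + lam ≠ 0 := by positivity
    rw [hr]
    field_simp
    ring
  have hdisj : ∀ n, Disjoint (OmegaSeq p q lam n) (ball x r) := by
    intro n
    induction n with
    | zero => exact empty_disjoint _
    | succ n ih =>
      refine disjoint_right.2 fun y hy => ?_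
      obtain ⟨L', hL'0, hL'r, hL'⟩ := reaches_of_disjoint_ball hM ih (mem_ball'.1 hy)
      refine ((h.mono (OmegaSeq_subset_Omega p q lam n)).trans hL0 hL'0 hL').notMem_OmegaSeq_succ
        (by positivity) ?_
      have hd : dist x p - r ≤ dist y p := by
        linarith [dist_triangle x y p, mem_ball'.1 hy]
      linarith [mul_le_mul_of_nonneg_left hd hlam]
  intro hx
  have hD : Disjoint (Omega p q lam) (ball x r) := by
    rw [Omega_eq_iUnion]
    exact disjoint_iUnion_left.2 hdisj
  exact disjoint_left.1 (hD.closure_left isOpen_ball) (frontier_subset_closure hx)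
    (mem_ball_self hr0)

lemma notMem_Omega_right (p q : M) {lam : ℝ} (hlam : 0 ≤ lam) : q ∉ Omega p q lam := by
  have h : ∀ n, q ∉ OmegaSeq p q lam n := by
    intro n
    induction n with
    | zero => exact notMem_empty q
    | succ n ih =>
      have hr : Reaches (OmegaSeq p q lam n) q q 0 :=
        ⟨fun _ => q, LipschitzWith.const' q, rfl, rfl, fun _ => ih⟩
      exact hr.notMem_OmegaSeq_succ le_rfl (by positivity)
  simpa [Omega] using fun n => h (n + 1)

/-- Every `x ∈ ∂Ω` is joined to `q` by a Lipschitz path of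
length exactly `λ d(x,p)` lying in `M ∖ Ω`; consequently every point of
`M ∖ Ω` is joined to `q` by a Lipschitz path of finite length in `M ∖ Ω`,
and in particular `M ∖ Ω` is path-connected. -/
theorem omega_complement_reachable
    {M : Type*} [MetricSpace M] [ProperSpace M] (hM : IsLengthSpace M)
    (p q : M) (hpq : p ≠ q) (lam : ℝ) (hlam : 1 < lam) :
    (∀ x ∈ frontier (Omega p q lam), ∃ (T : ℝ) (γ : ℝ → M), 0 ≤ T ∧
      γ 0 = q ∧ γ T = x ∧ (∃ K : ℝ≥0, LipschitzOnWith K γ (Set.Icc 0 T)) ∧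
      (∀ t ∈ Set.Icc 0 T, γ t ∉ Omega p q lam) ∧
      pathLength γ T = ENNReal.ofReal (lam * dist x p)) ∧
    (∀ x ∉ Omega p q lam, ∃ (T : ℝ) (γ : ℝ → M), 0 ≤ T ∧
      γ 0 = q ∧ γ T = x ∧ (∃ K : ℝ≥0, LipschitzOnWith K γ (Set.Icc 0 T)) ∧
      (∀ t ∈ Set.Icc 0 T, γ t ∉ Omega p q lam) ∧ pathLength γ T < ⊤) ∧
    IsPathConnected ((Omega p q lam)ᶜ) := by
  have hlam0 : 0 ≤ lam := by linarith
  refine ⟨fun x hx => ?_, fun x hx => ?_, q, notMem_Omega_right p q hlam0, fun {_} hx =>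
    (reaches_of_notMem_Omega hlam0 hx).joinedIn⟩
  · have hxΩ : x ∉ Omega p q lam := by
      rw [IsOpen.frontier_eq (isOpen_Omega p q hlam0)] at hx
      exact hx.2
    have hL0 : 0 ≤ lam * dist x p := by positivity
    obtain ⟨γ, h1, rfl, h3, h4⟩ := reaches_of_notMem_Omega hlam0 hxΩ
    refine ⟨lam * dist x p, γ, hL0, rfl, h3, ⟨1, h1.lipschitzOnWith⟩, fun t _ => h4 t,
      le_antisymm (pathLength_le_of_lipschitzWith h1 _) (le_of_not_gt fun hlt => ?_)⟩
    have hfin := hlt.ne_top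
    have hr := reaches_of_pathLength_le hL0 ENNReal.toReal_nonneg h1.lipschitzOnWith
      (fun t _ => h4 t) (ENNReal.ofReal_toReal hfin).ge
    rw [h3] at hr
    exact hr.notMem_frontier_Omega hM hlam0 ENNReal.toReal_nonneg
      ((ENNReal.lt_ofReal_iff_toReal_lt hfin).1 hlt) hx
  · obtain ⟨γ, h1, h2, h3, h4⟩ := reaches_of_notMem_Omega hlam0 hx
    exact ⟨lam * dist x p, γ, by positivity, h2, h3, ⟨1, h1.lipschitzOnWith⟩, fun t _ => h4 t,
      (pathLength_le_of_lipschitzWith h1 _).trans_lt ENNReal.ofReal_lt_top⟩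

end GrowthComp
end
end

section
/- Let M be a complete Riemannian manifold, p ≠ q ∈ M, and λ > 1. Then there exists a unique growth competition {A_t, B_t}_{t≥0} between p and q, and it is given explicitly by A_t = {x ∈ M∖Ω : d_Ω(x,q) ≤ λt} (the closed ball of radius λt about q in the metric space (M∖Ω, d_Ω)) and B_t = Ω ∩ 𝓑(p,t) for t > 0, together with A_0 = {q}, B_0 = {p}. -/
/-!
Formalization framework for "growth competitions" (after the paper's
Section 2), at the metric-space level.

Since Mathlib does not yet have Riemannian metrics, a complete Riemannian
manifold is represented by a proper (hence complete; Hopf-Rinow) metric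
space whose distance is the induced length (intrinsic) metric, and
spherical symmetry about `p` with warping function `G` is expressed through
global geodesic polar normal coordinates `Φ : ℝⁿ ≃ M` with `Φ 0 = p` and
`dist (Φ x) p = ‖x‖`, in which the Riemannian distance is the infimum of
lengths of Lipschitz curves measured in the warped metric
`g = dr² + G(r)² dθ²`.
-/

open Set Metric Filter MeasureTheory InnerProductGeometry NNReal ENNReal
open scoped RealInnerProductSpace Classical

noncomputable section

namespace GrowthComp

variable {M : Type*} [MetricSpace M]

/-- There is a `1`-Lipschitz curve avoiding `S` that is at `x` at time `0` and at `y` at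
time `L`. -/
def Reach (S : Set M) (L : ℝ) (x y : M) : Prop :=
  ∃ f : ℝ → M, LipschitzWith 1 f ∧ f 0 = x ∧ f L = y ∧ ∀ s, f s ∉ S

lemma abs_clamp_sub_clamp_le (a b v w : ℝ) :
    |max a (min b v) - max a (min b w)| ≤ |v - w| := by
  calc |max a (min b v) - max a (min b w)| ≤ |min b v - min b w| := by
        simpa using abs_max_sub_max_le_max a (min b v) a (min b w)
    _ ≤ |v - w| := by simpa using abs_min_sub_min_le_max b v b w

lemma lipschitzWith_one_of_dist_le {f : ℝ → M} (h : ∀ s t, dist (f s) (f t) ≤ |s - t|) :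
    LipschitzWith 1 f :=
  LipschitzWith.of_dist_le_mul fun s t => by simpa [Real.dist_eq] using h s t

lemma _root_.LipschitzWith.dist_le_abs_sub {f : ℝ → M} (h : LipschitzWith 1 f) (s t : ℝ) :
    dist (f s) (f t) ≤ |s - t| := by
  simpa [Real.dist_eq] using h.dist_le_mul s t

namespace Reach

variable {S : Set M} {L L' : ℝ} {x y z : M}

lemma right_notMem (h : Reach S L x y) : y ∉ S := by
  obtain ⟨f, -, -, rfl, hf⟩ := h
  exact hf L

lemma refl (hx : x ∉ S) (L : ℝ) : Reach S L x x :=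
  ⟨fun _ => x, LipschitzWith.const' x, rfl, rfl, fun _ => hx⟩

lemma symm (h : Reach S L x y) : Reach S L y x := by
  obtain ⟨f, hf, h0, hL, hS⟩ := h
  refine ⟨fun s => f (L - s), lipschitzWith_one_of_dist_le fun s t => ?_,
    by simpa using hL, by simpa using h0, fun s => hS _⟩
  refine (hf.dist_le_abs_sub _ _).trans_eq ?_
  rw [abs_sub_comm s t]
  congr 1
  ring

lemma trans (h : Reach S L x y) (h' : Reach S L' y z) (hL : 0 ≤ L) (hL' : 0 ≤ L') :
    Reach S (L + L') x z := by
  obtain ⟨f, hf, hf0, hfL, hfS⟩ := h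
  obtain ⟨g, hg, hg0, hgL, hgS⟩ := h'
  have key : ∀ s t, s ≤ L → L < t → dist (f s) (g (t - L)) ≤ t - s := by
    intro s t hs ht
    have h1 := hf.dist_le_abs_sub s L
    have h2 := hg.dist_le_abs_sub 0 (t - L)
    rw [abs_of_nonpos (by linarith)] at h1 h2
    rw [hfL] at h1
    rw [hg0] at h2
    linarith [dist_triangle (f s) y (g (t - L))]
  refine ⟨fun s => if s ≤ L then f s else g (s - L),
    lipschitzWith_one_of_dist_le fun s t => ?_, by simp [hL, hf0], ?_, fun s => ?_⟩
  · split_ifs with h1 h2 h2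
    · exact hf.dist_le_abs_sub s t
    · push Not at h2
      rw [abs_of_nonpos (by linarith)]
      linarith [key s t h1 h2]
    · push Not at h1
      rw [abs_of_nonneg (by linarith), dist_comm]
      linarith [key t s h2 h1]
    · simpa using hg.dist_le_abs_sub (s - L) (t - L)
  · dsimp only
    split_ifs with h1
    · obtain rfl : L' = 0 := by linarith
      rw [add_zero, hfL, ← hg0, hgL]
    · rw [add_sub_cancel_left, hgL]
  · dsimp only
    split_ifs
    · exact hfS _
    · exact hgS _

lemma mono_length (h : Reach S L x y) (hL : 0 ≤ L) (hLL' : L ≤ L') : Reach S L' x y := by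
  simpa using h.trans (refl h.right_notMem (L' - L)) hL (sub_nonneg.2 hLL')

lemma of_lipschitzOnWith {γ : ℝ → M} {K : ℝ≥0} (hK : 0 < K) {s : Set ℝ} {a b : ℝ}
    (hγ : LipschitzOnWith K γ s) (hab : a ≤ b) (hs : Icc a b ⊆ s)
    (hS : ∀ t ∈ Icc a b, γ t ∉ S) : Reach S (K * (b - a)) (γ a) (γ b) := by
  have hK' : (0 : ℝ) < K := hK
  have hmem : ∀ v : ℝ, max a (min b v) ∈ Icc a b := fun v =>
    ⟨le_max_left _ _, max_le hab (min_le_left _ _)⟩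
  refine ⟨fun v => γ (max a (min b (a + v / K))), lipschitzWith_one_of_dist_le fun v w => ?_,
    by simp [hab], ?_, fun v => hS _ (hmem _)⟩
  · refine (hγ.dist_le_mul _ (hs (hmem _)) _ (hs (hmem _))).trans ?_
    rw [Real.dist_eq]
    refine (mul_le_mul_of_nonneg_left (abs_clamp_sub_clamp_le _ _ _ _) hK'.le).trans_eq ?_
    rw [add_sub_add_left_eq_sub, ← _root_.sub_div, abs_div, abs_of_pos hK']
    field_simp
  · dsimp only
    rw [mul_div_cancel_left₀ _ hK'.ne', add_sub_cancel, min_self, max_eq_right hab]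

end Reach

lemma eVariationOn_Icc_le_of_lipschitzOnWith {γ : ℝ → M} {K : ℝ≥0} {s : Set ℝ} {a b : ℝ}
    (hγ : LipschitzOnWith K γ s) (hs : Icc a b ⊆ s) :
    eVariationOn γ (Icc a b) ≤ ENNReal.ofReal (K * (b - a)) := by
  have h1 : eVariationOn (γ ∘ id) (Icc a b) ≤ K * eVariationOn (id : ℝ → ℝ) (Icc a b) :=
    hγ.comp_eVariationOn_le fun t ht => hs ht
  have h2 : eVariationOn (id : ℝ → ℝ) (Icc a b) ≤ ENNReal.ofReal (b - a) := by simp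
  rw [ENNReal.ofReal_mul K.coe_nonneg, ENNReal.ofReal_coe_nnreal]
  exact h1.trans (by gcongr)

lemma dCompl_le_of_reach {S : Set M} {L : ℝ} {x y : M} (hL : 0 ≤ L) (h : Reach S L x y) :
    dCompl S x y ≤ ENNReal.ofReal L := by
  obtain ⟨f, hf, h0, hfL, hS⟩ := h
  refine sInf_le_of_le ⟨L, f, hL, h0, hfL, ⟨1, hf.lipschitzOnWith⟩, fun t _ => hS t, rfl⟩ ?_
  refine (eVariationOn_Icc_le_of_lipschitzOnWith (hf.lipschitzOnWith (s := univ))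
    (subset_univ _)).trans_eq ?_
  simp

/-- Arc-length reparametrization of a Lipschitz path. -/
lemma reach_pathLength {S : Set M} {T : ℝ} {γ : ℝ → M} {K : ℝ≥0} (hT : 0 ≤ T)
    (hγ : LipschitzOnWith K γ (Icc 0 T)) (hS : ∀ t ∈ Icc 0 T, γ t ∉ S) :
    Reach S (pathLength γ T).toReal (γ 0) (γ T) := by
  set σ : ℝ → ℝ := fun t => (pathLength γ t).toReal with hσ
  have hfin : ∀ a b, 0 ≤ a → a ≤ b → b ≤ T → eVariationOn γ (Icc a b) ≠ ∞ := fun a b ha hab hb =>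
    ((eVariationOn_Icc_le_of_lipschitzOnWith hγ (Icc_subset_Icc ha hb)).trans_lt
      ENNReal.ofReal_lt_top).ne
  have hadd : ∀ a b, 0 ≤ a → a ≤ b → b ≤ T →
      σ b - σ a = (eVariationOn γ (Icc a b)).toReal := by
    intro a b ha hab hb
    have := eVariationOn.Icc_add_Icc γ (s := univ) ha hab (mem_univ a)
    simp only [univ_inter] at this
    simp only [hσ, pathLength]
    rw [← this, ENNReal.toReal_add (hfin 0 a le_rfl ha (hab.trans hb)) (hfin a b ha hab hb)]
    ring
  have hdist : ∀ a b, 0 ≤ a → a ≤ b → b ≤ T → dist (γ a) (γ b) ≤ σ b - σ a := by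
    intro a b ha hab hb
    rw [hadd a b ha hab hb, dist_edist]
    exact ENNReal.toReal_mono (hfin a b ha hab hb)
      (eVariationOn.edist_le γ (left_mem_Icc.2 hab) (right_mem_Icc.2 hab))
  have hlip : ∀ a b, 0 ≤ a → a ≤ b → b ≤ T → σ b - σ a ≤ K * (b - a) := by
    intro a b ha hab hb
    rw [hadd a b ha hab hb]
    exact ENNReal.toReal_le_of_le_ofReal (mul_nonneg K.coe_nonneg (sub_nonneg.2 hab))
      (eVariationOn_Icc_le_of_lipschitzOnWith hγ (Icc_subset_Icc ha hb))
  have hdist' : ∀ a ∈ Icc 0 T, ∀ b ∈ Icc 0 T, dist (γ a) (γ b) ≤ |σ a - σ b| := by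
    intro a ha b hb
    rcases le_total a b with h | h
    · rw [abs_sub_comm]
      exact (hdist a b ha.1 h hb.2).trans (le_abs_self _)
    · rw [dist_comm]
      exact (hdist b a hb.1 h ha.2).trans (le_abs_self _)
  have hcont : ContinuousOn σ (Icc 0 T) := by
    refine (LipschitzOnWith.of_dist_le_mul (K := K) fun a ha b hb => ?_).continuousOn
    rw [Real.dist_eq, Real.dist_eq]
    rcases le_total a b with h | h
    · have := (dist_nonneg).trans (hdist a b ha.1 h hb.2)
      rw [abs_sub_comm, abs_of_nonneg this, abs_sub_comm, abs_of_nonneg (sub_nonneg.2 h)]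
      exact hlip a b ha.1 h hb.2
    · have := (dist_nonneg).trans (hdist b a hb.1 h ha.2)
      rw [abs_of_nonneg this, abs_of_nonneg (sub_nonneg.2 h)]
      exact hlip b a hb.1 h ha.2
  have hσ0 : σ 0 = 0 := by
    simp [hσ, pathLength]
  have hσT : 0 ≤ σ T := ENNReal.toReal_nonneg
  have hsurj : ∀ v : ℝ, ∃ t ∈ Icc 0 T, σ t = max 0 (min (σ T) v) := fun v =>
    intermediate_value_Icc hT hcont
      (by rw [hσ0]; exact ⟨le_max_left _ _, max_le hσT (min_le_left _ _)⟩)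
  choose τ hτ hστ using hsurj
  refine ⟨fun v => γ (τ v), lipschitzWith_one_of_dist_le fun v w => ?_, ?_, ?_,
    fun v => hS _ (hτ v)⟩
  · refine (hdist' _ (hτ v) _ (hτ w)).trans ?_
    rw [hστ, hστ]
    exact abs_clamp_sub_clamp_le _ _ _ _
  · have := hdist' _ (hτ 0) 0 (left_mem_Icc.2 hT)
    rw [hστ, hσ0, min_eq_right hσT, max_self, sub_zero, abs_zero] at this
    exact dist_le_zero.1 this
  · have := hdist' _ (hτ (σ T)) T (right_mem_Icc.2 hT)
    rw [hστ, min_self, max_eq_right hσT, sub_self, abs_zero] at this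
    exact dist_le_zero.1 this

lemma reach_of_dCompl_lt {S : Set M} {L : ℝ} {x y : M}
    (h : dCompl S x y < ENNReal.ofReal L) : Reach S L x y := by
  obtain ⟨_, ⟨T, γ, hT, rfl, rfl, ⟨K, hK⟩, hS, rfl⟩, hlt⟩ := sInf_lt_iff.1 h
  exact (reach_pathLength hT hK hS).mono_length ENNReal.toReal_nonneg
    (ENNReal.toReal_le_of_le_ofReal (ENNReal.ofReal_pos.1 (pos_of_gt hlt)).le hlt.le)

/-- Compactness of curves in a proper space: limits of curves avoiding larger and larger open
sets avoid the union. -/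
lemma Reach.of_tendsto [ProperSpace M] {S : ℕ → Set M} (hS : ∀ n, IsOpen (S n))
    (hmono : Monotone S) {q x : M} {u : ℕ → M} (hu : Tendsto u atTop (nhds x))
    {l : ℕ → ℝ} {L : ℝ} (hl : Tendsto l atTop (nhds L))
    (h : ∀ n, Reach (S n) (l n) q (u n)) : Reach (⋃ n, S n) L q x := by
  choose f hf hf0 hfl hfS using h
  have hlim : ∀ s : ℝ, ∃ y, Tendsto (fun n => f n s) (hyperfilter ℕ) (nhds y) := by
    intro s
    obtain ⟨y, -, hy⟩ := (isCompact_closedBall q |s|).ultrafilter_le_nhds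
      ((hyperfilter ℕ).map fun n => f n s) (by
        refine tendsto_principal.2 (Eventually.of_forall fun n => ?_)
        simpa [hf0] using (hf n).dist_le_abs_sub s 0)
    exact ⟨y, hy⟩
  choose g hg using hlim
  have hle : (hyperfilter ℕ : Filter ℕ) ≤ atTop := Nat.hyperfilter_le_atTop
  refine ⟨g, lipschitzWith_one_of_dist_le fun s t => ?_, ?_, ?_, fun s hs => ?_⟩
  · exact le_of_tendsto ((hg s).dist (hg t))
      (Eventually.of_forall fun n => (hf n).dist_le_abs_sub s t)
  · refine tendsto_nhds_unique (hg 0) ?_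
    simp [hf0]
  · have h1 : Tendsto (fun n => dist (f n L) (u n)) (hyperfilter ℕ) (nhds 0) := by
      refine squeeze_zero (fun _ => dist_nonneg) (fun n => ?_)
        (tendsto_iff_dist_tendsto_zero.1 (hl.mono_left hle))
      rw [← hfl n, Real.dist_eq, abs_sub_comm]
      exact (hf n).dist_le_abs_sub L (l n)
    exact dist_eq_zero.1 (tendsto_nhds_unique ((hg L).dist (hu.mono_left hle)) h1)
  · obtain ⟨m, hm⟩ := mem_iUnion.1 hs
    have h1 : ∀ᶠ n in (hyperfilter ℕ : Filter ℕ), f n s ∈ S m :=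
      (hg s).eventually ((hS m).mem_nhds hm)
    obtain ⟨n, hn, hmn⟩ := (h1.and (hle (eventually_ge_atTop m))).exists
    exact hfS n s (hmono hmn hn)

lemma dCompl_le_iff_reach [ProperSpace M] {S : Set M} (hS : IsOpen S) {L : ℝ} (hL : 0 ≤ L)
    {x q : M} : dCompl S x q ≤ ENNReal.ofReal L ↔ Reach S L q x := by
  refine ⟨fun h => ?_, fun h => dCompl_le_of_reach hL h.symm⟩
  have hl : Tendsto (fun n : ℕ => L + 1 / ((n : ℝ) + 1)) atTop (nhds L) := by
    simpa using tendsto_one_div_add_atTop_nhds_zero_nat.const_add L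
  have := Reach.of_tendsto (S := fun _ => S) (fun _ => hS) monotone_const
    (tendsto_const_nhds (x := x)) hl (q := q) fun n => by
      have hn : (0 : ℝ) < 1 / ((n : ℝ) + 1) := Nat.one_div_pos_of_nat
      exact (reach_of_dCompl_lt (h.trans_lt
        ((ENNReal.ofReal_lt_ofReal_iff (by linarith)).2 (by linarith)))).symm
  simpa [iUnion_const] using this

section Omega

variable {p q : M} {lam : ℝ}

lemma omegaSeq_mono : Monotone (OmegaSeq p q lam) :=
  monotone_nat_of_le_succ fun _ => subset_union_left

lemma mem_omega_iff {x : M} : x ∈ Omega p q lam ↔ ∃ n, x ∈ OmegaSeq p q lam n := by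
  simp only [Omega, mem_iUnion]
  exact ⟨fun ⟨n, h⟩ => ⟨n + 1, h⟩, fun ⟨n, h⟩ => ⟨n, omegaSeq_mono n.le_succ h⟩⟩

lemma omega_eq_iUnion : Omega p q lam = ⋃ n, OmegaSeq p q lam n := by
  ext x
  rw [mem_omega_iff, mem_iUnion]

lemma omegaSeq_subset_omega (n : ℕ) : OmegaSeq p q lam n ⊆ Omega p q lam := fun _ h =>
  mem_omega_iff.2 ⟨n, h⟩

lemma dist_eq_of_minimizing {f : ℝ → M} (hf : LipschitzWith 1 f) (h0 : f 0 = p) {x : M}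
    (hx : f (dist p x) = x) {s : ℝ} (hs : s ∈ Icc 0 (dist p x)) : dist (f s) p = s := by
  have h1 := hf.dist_le_abs_sub s 0
  have h2 := hf.dist_le_abs_sub s (dist p x)
  rw [h0, sub_zero, abs_of_nonneg hs.1] at h1
  rw [hx, abs_of_nonpos (by linarith [hs.2])] at h2
  linarith [dist_triangle p (f s) x, dist_comm p (f s)]

variable [ProperSpace M]

lemma notMem_omegaSeq_succ_of_isOpen (hlam : 0 ≤ lam) {n : ℕ}
    (hn : IsOpen (OmegaSeq p q lam n)) {x : M} :
    x ∉ OmegaSeq p q lam (n + 1) ↔ Reach (OmegaSeq p q lam n) (lam * dist x p) q x := by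
  rw [← dCompl_le_iff_reach hn (by positivity)]
  simp only [OmegaSeq, mem_union, mem_ofPred_eq, not_or, not_and, not_lt]
  refine ⟨fun h => h.2 h.1, fun h => ⟨?_, fun _ => h⟩⟩
  exact ((dCompl_le_iff_reach hn (by positivity)).1 h).right_notMem

lemma isOpen_omegaSeq (hlam : 0 ≤ lam) (n : ℕ) : IsOpen (OmegaSeq p q lam n) := by
  induction n with
  | zero => exact isOpen_empty
  | succ n ih =>
    rw [← isClosed_compl_iff]
    refine IsSeqClosed.isClosed fun u x hu hx => ?_
    have hl : Tendsto (fun k => lam * dist (u k) p) atTop (nhds (lam * dist x p)) :=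
      (hx.dist tendsto_const_nhds).const_mul lam
    have := Reach.of_tendsto (S := fun _ => OmegaSeq p q lam n) (fun _ => ih) monotone_const hx hl
      fun k => (notMem_omegaSeq_succ_of_isOpen hlam ih).1 (hu k)
    rw [iUnion_const] at this
    exact (notMem_omegaSeq_succ_of_isOpen hlam ih).2 this

lemma isOpen_omega (hlam : 0 ≤ lam) : IsOpen (Omega p q lam) :=
  isOpen_iUnion fun n => isOpen_omegaSeq hlam (n + 1)

lemma notMem_omegaSeq_succ (hlam : 0 ≤ lam) {n : ℕ} {x : M} :
    x ∉ OmegaSeq p q lam (n + 1) ↔ Reach (OmegaSeq p q lam n) (lam * dist x p) q x :=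
  notMem_omegaSeq_succ_of_isOpen hlam (isOpen_omegaSeq hlam n)

lemma reach_omega_of_notMem (hlam : 0 ≤ lam) {x : M} (hx : x ∉ Omega p q lam) :
    Reach (Omega p q lam) (lam * dist x p) q x := by
  rw [omega_eq_iUnion]
  exact Reach.of_tendsto (isOpen_omegaSeq hlam) omegaSeq_mono tendsto_const_nhds
    tendsto_const_nhds fun n =>
      (notMem_omegaSeq_succ hlam).1 fun h => hx (omegaSeq_subset_omega (n + 1) h)

lemma right_notMem_omega (hlam : 0 ≤ lam) : q ∉ Omega p q lam := by
  rw [mem_omega_iff]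
  rintro ⟨n, hn⟩
  induction n with
  | zero => exact hn
  | succ n ih => exact (notMem_omegaSeq_succ hlam).2 (Reach.refl ih _) hn

lemma left_mem_omega (hlam : 0 ≤ lam) (hpq : p ≠ q) : p ∈ Omega p q lam := by
  by_contra h
  obtain ⟨f, -, h0, h1, -⟩ := reach_omega_of_notMem hlam h
  rw [dist_self, mul_zero] at h1
  exact hpq (h1.symm.trans h0)

lemma exists_minimizing_curve (hM : IsLengthSpace M) (x y : M) :
    ∃ f : ℝ → M, LipschitzWith 1 f ∧ f 0 = x ∧ f (dist x y) = y := by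
  obtain ⟨f, hf, h0, h1, -⟩ := (dCompl_le_iff_reach isOpen_empty dist_nonneg).1
    (dist_comm x y ▸ (hM y x).ge)
  exact ⟨f, hf, h0, h1⟩

/-- The complements of the sets `Ω_n` are closed under moving away from `p` along minimizing
curves, i.e. each `Ω_n` is star-shaped about `p`. -/
lemma notMem_omegaSeq_of_le (hlam : 1 ≤ lam) {f : ℝ → M} (hf : LipschitzWith 1 f)
    (h0 : f 0 = p) {x : M} (hx : f (dist p x) = x) {s t : ℝ} (hs : 0 ≤ s) (hst : s ≤ t)
    (ht : t ≤ dist p x) {n : ℕ} (hn : f s ∉ OmegaSeq p q lam n) :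
    f t ∉ OmegaSeq p q lam n := by
  have hlam0 : 0 ≤ lam := zero_le_one.trans hlam
  induction n generalizing t with
  | zero => exact notMem_empty _
  | succ n ih =>
    have hsn : f s ∉ OmegaSeq p q lam n := fun h => hn (omegaSeq_mono n.le_succ h)
    have h1 := (notMem_omegaSeq_succ hlam0).1 hn
    rw [dist_eq_of_minimizing hf h0 hx ⟨hs, hst.trans ht⟩] at h1
    have h2 : Reach (OmegaSeq p q lam n) ((1 : ℝ≥0) * (t - s)) (f s) (f t) :=
      Reach.of_lipschitzOnWith one_pos hf.lipschitzOnWith hst (subset_univ _)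
        fun v hv => ih hv.1 (hv.2.trans ht) hsn
    rw [NNReal.coe_one, one_mul] at h2
    refine (notMem_omegaSeq_succ hlam0).2 ?_
    rw [dist_eq_of_minimizing hf h0 hx ⟨hs.trans hst, ht⟩]
    exact (h1.trans h2 (by positivity) (sub_nonneg.2 hst)).mono_length
      (add_nonneg (by positivity) (sub_nonneg.2 hst)) (by nlinarith)

end Omega

section Competition

variable {p q : M} {lam : ℝ} {A B : ℝ → Set M}

lemma AvoidsB.mono {s t : ℝ} {γ : ℝ → M} (h : AvoidsB q lam B t γ) (hst : s ≤ t) :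
    AvoidsB q lam B s γ :=
  ⟨h.1, h.2.1.mono (Icc_subset_Icc_right hst), fun v hv => h.2.2 v ⟨hv.1, hv.2.trans hst⟩⟩

lemma AvoidsA.mono {s t : ℝ} {η : ℝ → M} (h : AvoidsA p A t η) (hst : s ≤ t) :
    AvoidsA p A s η :=
  ⟨h.1, h.2.1.mono (Icc_subset_Icc_right hst), fun v hv => h.2.2 v ⟨hv.1, hv.2.trans hst⟩⟩

lemma AvoidsB.reach {t : ℝ} {γ : ℝ → M} (hlam : 0 < lam) (h : AvoidsB q lam B t γ) {S : Set M}
    {s : ℝ} (hs : s ∈ Icc 0 t) (hS : ∀ v ∈ Icc 0 s, γ v ∉ S) : Reach S (lam * s) q (γ s) := by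
  have := Reach.of_lipschitzOnWith (Real.toNNReal_pos.2 hlam) h.2.1 hs.1
    (Icc_subset_Icc_right hs.2) hS
  rwa [h.1, Real.coe_toNNReal _ hlam.le, sub_zero] at this

lemma lipschitzWith_comp_mul {f : ℝ → M} (hf : LipschitzWith 1 f) (hlam : 0 < lam) :
    LipschitzWith (Real.toNNReal lam) fun s => f (lam * s) :=
  LipschitzWith.of_dist_le_mul fun s t => by
    refine (hf.dist_le_abs_sub _ _).trans_eq ?_
    rw [← mul_sub, abs_mul, abs_of_pos hlam, Real.coe_toNNReal _ hlam.le, Real.dist_eq]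

/-- The curve that follows `f` until time `d` and then stays at `f d`. -/
lemma lipschitzWith_comp_min {f : ℝ → M} (hf : LipschitzWith 1 f) (d : ℝ) :
    LipschitzWith 1 fun s => f (min d s) :=
  lipschitzWith_one_of_dist_le fun s t => (hf.dist_le_abs_sub _ _).trans <| by
    simpa using abs_min_sub_min_le_max d s d t

namespace IsGrowthCompetition

lemma mem_A_of_avoidsB (h : IsGrowthCompetition p q lam A B)
    {t s : ℝ} {γ : ℝ → M} (hγ : AvoidsB q lam B t γ) (hs : s ∈ Icc 0 t) :
    γ s ∈ A s := by
  rcases hs.1.eq_or_lt with rfl | h0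
  · rw [h.A_zero, hγ.1]
    rfl
  · rw [h.A_eq s h0]
    exact ⟨γ, hγ.mono hs.2, s, right_mem_Icc.2 hs.1, rfl⟩

lemma disjoint_of_pos (h : IsGrowthCompetition p q lam A B)
    {t : ℝ} (ht : 0 < t) {x : M} (hA : x ∈ A t) : x ∉ B t := by
  intro hB
  rw [h.A_eq t ht] at hA
  rw [h.B_eq t ht] at hB
  obtain ⟨γ, hγ, u, hu, hγu⟩ := hA
  obtain ⟨η, hη, v, hv, hηv⟩ := hB
  have hxA : x ∈ A u := hγu ▸ h.mem_A_of_avoidsB hγ hu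
  have hvu : v < u := by
    by_contra! huv
    exact hη.2.2 v ⟨hv.1, hv.2.le⟩ (hηv ▸ h.monoA hu.1 huv hxA)
  refine hγ.2.2 u hu ?_
  rw [h.B_eq u (hv.1.trans_lt hvu), hγu]
  exact ⟨η, hη.mono hu.2, v, ⟨hv.1, hvu⟩, hηv⟩

lemma disjoint_of_nonneg (h : IsGrowthCompetition p q lam A B)
    {s t : ℝ} (hs : 0 ≤ s) (ht : 0 ≤ t) {x : M} (hA : x ∈ A s) :
    x ∉ B t := fun hB =>
  h.disjoint_of_pos (t := max s t + 1) (by positivity)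
    (h.monoA hs ((le_max_left s t).trans (by linarith)) hA)
    (h.monoB ht ((le_max_right s t).trans (by linarith)) hB)

lemma dist_lt_of_mem_B (h : IsGrowthCompetition p q lam A B)
    {t : ℝ} (ht : 0 < t) {x : M} (hB : x ∈ B t) : dist x p < t := by
  rw [h.B_eq t ht] at hB
  obtain ⟨η, hη, v, hv, rfl⟩ := hB
  have := hη.2.1.dist_le_mul v ⟨hv.1, hv.2.le⟩ 0 (left_mem_Icc.2 ht.le)
  rw [hη.1, Real.dist_eq, sub_zero, abs_of_nonneg hv.1, NNReal.coe_one, one_mul] at this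
  exact this.trans_lt hv.2

lemma reach_of_mem_A (h : IsGrowthCompetition p q lam A B)
    (hlam : 0 < lam) {S : Set M} (hS : ∀ x ∈ S, ∃ t, 0 ≤ t ∧ x ∈ B t)
    {t : ℝ} (ht : 0 < t) {x : M} (hA : x ∈ A t) : Reach S (lam * t) q x := by
  rw [h.A_eq t ht] at hA
  obtain ⟨γ, hγ, u, hu, rfl⟩ := hA
  refine (hγ.reach hlam hu fun v hv hvS => ?_).mono_length (mul_nonneg hlam.le hu.1)
    (mul_le_mul_of_nonneg_left hu.2 hlam.le)
  obtain ⟨r, hr, hBr⟩ := hS _ hvS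
  exact h.disjoint_of_nonneg hv.1 hr (h.mem_A_of_avoidsB hγ ⟨hv.1, hv.2.trans hu.2⟩) hBr

variable [ProperSpace M]

lemma mem_B_of_mem_omegaSeq (h : IsGrowthCompetition p q lam A B)
    (hM : IsLengthSpace M) (hpq : p ≠ q) (hlam : 1 < lam) (n : ℕ)
    {x : M} (hx : x ∈ OmegaSeq p q lam n) {t : ℝ} (ht : dist x p < t) : x ∈ B t := by
  have hlam0 : 0 < lam := zero_lt_one.trans hlam
  induction n generalizing x t with
  | zero => exact absurd hx (notMem_empty x)
  | succ n ih =>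
    by_cases hxn : x ∈ OmegaSeq p q lam n
    · exact ih hxn ht
    have hsub : ∀ y ∈ OmegaSeq p q lam n, ∃ t, 0 ≤ t ∧ y ∈ B t := fun y hy =>
      ⟨dist y p + 1, by positivity, ih hy (by linarith)⟩
    have hlt : ENNReal.ofReal (lam * dist x p) < dCompl (OmegaSeq p q lam n) x q := by
      rcases hx with hx | hx
      · exact absurd hx hxn
      · exact hx.2
    obtain ⟨r, hr0, hr1, hr2⟩ := ENNReal.lt_iff_exists_real_btwn.1 hlt
    have hr3 : lam * dist x p < r := (ENNReal.ofReal_lt_ofReal_iff_of_nonneg (by positivity)).1 hr1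
    have hnr : ¬ Reach (OmegaSeq p q lam n) r q x := fun hR =>
      hr2.not_ge (dCompl_le_of_reach hr0 hR.symm)
    obtain ⟨f, hf, hf0, hf1⟩ := exists_minimizing_curve hM p x
    set d := dist p x with hd
    rw [dist_comm x p, ← hd] at ht hr3
    have hd0 : 0 ≤ d := dist_nonneg
    -- up to time `r / lam > d` the curve that runs along `f` and then waits at `x` avoids `A`
    have havoid : ∀ s, 0 ≤ s → lam * s ≤ r → f (min d s) ∉ A s := by
      intro s hs0 hsr hA
      rcases hs0.eq_or_lt with rfl | hs
      · rw [min_eq_right hd0, hf0, h.A_zero] at hA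
        exact hpq hA
      have hR := h.reach_of_mem_A hlam0 hsub hs hA
      rcases le_total d s with hds | hsd
      · rw [min_eq_left hds, hf1] at hR
        exact hnr (hR.mono_length (by positivity) hsr)
      · rw [min_eq_right hsd] at hR
        have h2 : Reach (OmegaSeq p q lam n) ((1 : ℝ≥0) * (d - s)) (f s) (f d) :=
          Reach.of_lipschitzOnWith one_pos hf.lipschitzOnWith hsd (subset_univ _) fun v hv =>
            notMem_omegaSeq_of_le hlam.le hf hf0 hf1 hs0 hv.1 hv.2 hR.right_notMem
        rw [hf1, NNReal.coe_one, one_mul] at h2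
        exact hnr ((hR.trans h2 (by positivity) (sub_nonneg.2 hsd)).mono_length
          (add_nonneg (by positivity) (sub_nonneg.2 hsd)) (by nlinarith))
    have hdr : d < r / lam := by rwa [lt_div_iff₀ hlam0, mul_comm]
    have hdu : d < min t (r / lam) := lt_min ht hdr
    refine h.monoB (hd0.trans hdu.le) (min_le_left t (r / lam)) ?_
    rw [h.B_eq _ (hd0.trans_lt hdu)]
    refine ⟨fun s => f (min d s), ⟨by simp [hd0, hf0],
      (lipschitzWith_comp_min hf d).lipschitzOnWith, fun s hs => havoid s hs.1 ?_⟩,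
      d, ⟨hd0, hdu⟩, by simp [hf1]⟩
    have := hs.2.trans (min_le_right t (r / lam))
    rwa [le_div_iff₀ hlam0, mul_comm] at this

lemma mem_A_of_reach_omega (h : IsGrowthCompetition p q lam A B)
    (hpq : p ≠ q) (hlam : 1 < lam) {t : ℝ} (ht : 0 ≤ t) {x : M}
    (hx : Reach (Omega p q lam) (lam * t) q x) : x ∈ A t := by
  have hlam0 : 0 < lam := zero_lt_one.trans hlam
  have hopen : IsOpen (Omega p q lam) := isOpen_omega hlam0.le
  have hle := dCompl_le_of_reach (by positivity) hx.symm
  have hfin : dCompl (Omega p q lam) x q ≠ ∞ := (hle.trans_lt ENNReal.ofReal_lt_top).ne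
  set L := (dCompl (Omega p q lam) x q).toReal
  have hL0 : 0 ≤ L := ENNReal.toReal_nonneg
  have hLt : L ≤ lam * t := ENNReal.toReal_le_of_le_ofReal (by positivity) hle
  have hmin : ∀ r, 0 ≤ r → Reach (Omega p q lam) r q x → L ≤ r := fun r hr hR =>
    ENNReal.toReal_le_of_le_ofReal hr (dCompl_le_of_reach hr hR.symm)
  obtain ⟨f, hf, hf0, hf1, hfS⟩ : Reach (Omega p q lam) L q x :=
    (dCompl_le_iff_reach hopen hL0).1 (ENNReal.ofReal_toReal hfin).ge
  have hdist : ∀ v ∈ Icc 0 L, v ≤ lam * dist (f v) p := by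
    intro v hv
    have h2 : Reach (Omega p q lam) ((1 : ℝ≥0) * (L - v)) (f v) (f L) :=
      Reach.of_lipschitzOnWith one_pos hf.lipschitzOnWith hv.2 (subset_univ _) fun w _ => hfS w
    rw [NNReal.coe_one, one_mul, hf1] at h2
    have hlv := sub_nonneg.2 hv.2
    have := hmin _ (by positivity) ((reach_omega_of_notMem hlam0.le (hfS v)).trans h2
      (by positivity) hlv)
    linarith
  have hLl : L / lam ≤ t := by rwa [div_le_iff₀ hlam0, mul_comm]
  have hmul : lam * (L / lam) = L := mul_div_cancel₀ L hlam0.ne'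
  refine h.monoA (by positivity) hLl ?_
  have hav : AvoidsB q lam B (L / lam) fun s => f (lam * s) := by
    refine ⟨by simp [hf0], (lipschitzWith_comp_mul hf hlam0).lipschitzOnWith, fun s hs hB => ?_⟩
    rcases hs.1.eq_or_lt with rfl | hs0
    · dsimp only at hB
      rw [mul_zero, hf0, h.B_zero] at hB
      exact hpq (mem_singleton_iff.1 hB).symm
    · have h1 := hdist (lam * s) ⟨by positivity, by
        rw [← hmul]; exact mul_le_mul_of_nonneg_left hs.2 hlam0.le⟩
      exact (le_of_mul_le_mul_left h1 hlam0).not_gt (h.dist_lt_of_mem_B hs0 hB)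
  have := h.mem_A_of_avoidsB hav (right_mem_Icc.2 (by positivity))
  simpa only [hmul, hf1] using this

lemma eq_omega (h : IsGrowthCompetition p q lam A B)
    (hM : IsLengthSpace M) (hpq : p ≠ q) (hlam : 1 < lam) {t : ℝ} (ht : 0 < t) :
    A t = {x | Reach (Omega p q lam) (lam * t) q x} ∧ B t = Omega p q lam ∩ ball p t := by
  have hlam0 : 0 < lam := zero_lt_one.trans hlam
  have hB : ∀ x ∈ Omega p q lam, ∀ s, dist x p < s → x ∈ B s := by
    intro x hx s hs
    obtain ⟨n, hn⟩ := mem_omega_iff.1 hx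
    exact h.mem_B_of_mem_omegaSeq hM hpq hlam n hn hs
  refine ⟨Subset.antisymm (fun x hx => ?_) fun x hx =>
    h.mem_A_of_reach_omega hpq hlam ht.le hx, Subset.antisymm (fun x hx => ⟨?_, ?_⟩) fun x hx =>
    hB x hx.1 t hx.2⟩
  · exact h.reach_of_mem_A hlam0
      (fun y hy => ⟨dist y p + 1, by positivity, hB y hy _ (by linarith)⟩) ht hx
  · by_contra hxn
    exact h.disjoint_of_nonneg dist_nonneg ht.le
      (h.mem_A_of_reach_omega hpq hlam dist_nonneg (reach_omega_of_notMem hlam0.le hxn)) hx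
  · exact h.dist_lt_of_mem_B ht hx

end IsGrowthCompetition

lemma isGrowthCompetition_omega [ProperSpace M] (hM : IsLengthSpace M) (hpq : p ≠ q)
    (hlam : 1 < lam) :
    IsGrowthCompetition p q lam
      (fun t => if t = 0 then {q} else {x | Reach (Omega p q lam) (lam * t) q x})
      (fun t => if t = 0 then {p} else Omega p q lam ∩ ball p t) where
  monoA s t hs hst := by
    have hlam0 : 0 < lam := zero_lt_one.trans hlam
    split_ifs with h1 h2 h2
    · exact Subset.rfl
    · exact singleton_subset_iff.2 (Reach.refl (right_notMem_omega hlam0.le) _)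
    · exact absurd (le_antisymm (h2 ▸ hst) hs) h1
    · exact fun x hx => Reach.mono_length hx (by positivity)
        (mul_le_mul_of_nonneg_left hst hlam0.le)
  monoB s t hs hst := by
    split_ifs with h1 h2 h2
    · exact Subset.rfl
    · exact singleton_subset_iff.2 ⟨left_mem_omega (by linarith) hpq,
        mem_ball_self ((hs.trans hst).lt_of_ne' h2)⟩
    · exact absurd (le_antisymm (h2 ▸ hst) hs) h1
    · exact inter_subset_inter_right _ (ball_subset_ball hst)
  A_zero := if_pos rfl
  B_zero := if_pos rfl
  A_eq t ht := by
    have hlam0 : 0 < lam := zero_lt_one.trans hlam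
    rw [if_neg ht.ne']
    refine Subset.antisymm ?_ ?_
    · rintro x ⟨f, hf, hf0, hf1, hfS⟩
      refine ⟨fun s => f (lam * s), ⟨by simp [hf0],
        (lipschitzWith_comp_mul hf hlam0).lipschitzOnWith, fun s _ => ?_⟩,
        t, right_mem_Icc.2 ht.le, hf1⟩
      dsimp only
      split_ifs with h1
      · simpa [h1, hf0] using hpq.symm
      · exact fun hB => hfS _ hB.1
    · rintro x ⟨γ, hγ, s, hs, rfl⟩
      have key : ∀ n, ∀ v ∈ Icc 0 t, γ v ∉ OmegaSeq p q lam n := by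
        intro n
        induction n with
        | zero => exact fun _ _ => notMem_empty _
        | succ n ih =>
          intro v hv hmem
          have hR : Reach (OmegaSeq p q lam n) (lam * v) q (γ v) :=
            hγ.reach hlam0 hv fun w hw => ih w ⟨hw.1, hw.2.trans hv.2⟩
          have hvd : v ≤ dist (γ v) p := by
            rcases hv.1.eq_or_lt with h0 | h0
            · exact h0 ▸ dist_nonneg
            · have := hγ.2.2 v hv
              dsimp only at this
              rw [if_neg h0.ne'] at this
              exact not_lt.1 fun hlt => this ⟨omegaSeq_subset_omega _ hmem, hlt⟩
          exact (notMem_omegaSeq_succ hlam0.le).2 (hR.mono_length (mul_nonneg hlam0.le hv.1)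
            (mul_le_mul_of_nonneg_left hvd hlam0.le)) hmem
      refine (hγ.reach hlam0 hs fun v hv hmem => ?_).mono_length (mul_nonneg hlam0.le hs.1)
        (mul_le_mul_of_nonneg_left hs.2 hlam0.le)
      obtain ⟨n, hn⟩ := mem_omega_iff.1 hmem
      exact key n v ⟨hv.1, hv.2.trans hs.2⟩ hn
  B_eq t ht := by
    have hlam0 : 0 < lam := zero_lt_one.trans hlam
    rw [if_neg ht.ne']
    refine Subset.antisymm ?_ ?_
    · rintro x ⟨hx, hxt⟩
      obtain ⟨n, hn⟩ := mem_omega_iff.1 hx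
      obtain ⟨f, hf, hf0, hf1⟩ := exists_minimizing_curve hM p x
      have hmem : ∀ s ∈ Icc 0 (dist p x), f s ∈ Omega p q lam := by
        intro s hs
        by_contra hc
        refine notMem_omegaSeq_of_le hlam.le hf hf0 hf1 hs.1 hs.2 le_rfl
          (fun h => hc (omegaSeq_subset_omega n h)) ?_
        rwa [hf1]
      refine ⟨fun s => f (min (dist p x) s), ⟨by simp [hf0],
        (lipschitzWith_comp_min hf _).lipschitzOnWith, fun s hs => ?_⟩,
        dist p x, ⟨dist_nonneg, by rwa [dist_comm]⟩, by simp [hf1]⟩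
      dsimp only
      split_ifs with h1
      · simpa [h1, hf0] using hpq
      · exact fun hA => Reach.right_notMem hA
          (hmem _ ⟨le_min dist_nonneg hs.1, min_le_left _ _⟩)
    · rintro x ⟨η, hη, s, hs, rfl⟩
      have hd := hη.2.1.dist_le_mul s ⟨hs.1, hs.2.le⟩ 0 (left_mem_Icc.2 ht.le)
      rw [hη.1, Real.dist_eq, sub_zero, abs_of_nonneg hs.1, NNReal.coe_one, one_mul] at hd
      refine ⟨?_, hd.trans_lt hs.2⟩
      rcases hs.1.eq_or_lt with rfl | h0
      · rw [hη.1]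
        exact left_mem_omega hlam0.le hpq
      · by_contra hc
        have := hη.2.2 s ⟨hs.1, hs.2.le⟩
        dsimp only at this
        rw [if_neg h0.ne'] at this
        exact this ((reach_omega_of_notMem hlam0.le hc).mono_length (by positivity)
          (mul_le_mul_of_nonneg_left hd hlam0.le))

end Competition

/-- Corollary 2.8.  For every `p ≠ q` and `λ > 1` there
exists a growth competition between `p` and `q`, and it is unique: any
growth competition is given by `A_t = \overline{𝓑}_Ω(q, λt)` (the closed
ball about `q` in the intrinsic metric of `M ∖ Ω`) and `B_t = Ω ∩ 𝓑(p,t)`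
for `t > 0` (the values `A 0 = {q}`, `B 0 = {p}` being part of the
definition). -/
theorem competition_exists_unique
    {M : Type*} [MetricSpace M] [ProperSpace M] (hM : IsLengthSpace M)
    (p q : M) (hpq : p ≠ q) (lam : ℝ) (hlam : 1 < lam) :
    (∃ A B : ℝ → Set M, IsGrowthCompetition p q lam A B) ∧
    ∀ A B : ℝ → Set M, IsGrowthCompetition p q lam A B → ∀ t : ℝ, 0 < t →
      A t = {x | x ∉ Omega p q lam ∧
        dCompl (Omega p q lam) x q ≤ ENNReal.ofReal (lam * t)} ∧
      B t = Omega p q lam ∩ Metric.ball p t := by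
  have hlam0 : 0 < lam := zero_lt_one.trans hlam
  refine ⟨⟨_, _, isGrowthCompetition_omega hM hpq hlam⟩, fun A B h t ht => ?_⟩
  obtain ⟨hA, hB⟩ := h.eq_omega hM hpq hlam ht
  refine ⟨hA.trans (Set.ext fun x => ?_), hB⟩
  simp only [mem_ofPred_eq]
  rw [dCompl_le_iff_reach (isOpen_omega hlam0.le) (by positivity)]
  exact ⟨fun hR => ⟨hR.right_notMem, hR⟩, And.right⟩

end GrowthComp
end
end

section
/- For the growth competition on Euclidean space ℝⁿ (n ≥ 2) between any two distinct points p and q with any λ > 1, the set B_∞ is bounded. -/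
/-!
Formalization framework for "growth competitions" (after the paper's
Section 2), at the metric-space level.

Since Mathlib does not yet have Riemannian metrics, a complete Riemannian
manifold is represented by a proper (hence complete; Hopf-Rinow) metric
space whose distance is the induced length (intrinsic) metric, and
spherical symmetry about `p` with warping function `G` is expressed through
global geodesic polar normal coordinates `Φ : ℝⁿ ≃ M` with `Φ 0 = p` and
`dist (Φ x) p = ‖x‖`, in which the Riemannian distance is the infimum of
lengths of Lipschitz curves measured in the warped metric
`g = dr² + G(r)² dθ²`.
-/

open Set Metric Filter MeasureTheory InnerProductGeometry NNReal ENNReal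
open scoped RealInnerProductSpace Classical

noncomputable section

namespace GrowthComp

variable {M : Type*} [MetricSpace M]

lemma exists_unit_orthogonal {E : Type*} [NormedAddCommGroup E] [InnerProductSpace ℝ E]
    [FiniteDimensional ℝ E] (hE : 2 ≤ Module.finrank ℝ E) (v : E) :
    ∃ w : E, ‖w‖ = 1 ∧ ⟪v, w⟫ = 0 := by
  have hne : (ℝ ∙ v)ᗮ ≠ ⊥ := by
    intro h
    rw [Submodule.orthogonal_eq_bot_iff] at h
    have h1 := finrank_span_le_card (R := ℝ) ({v} : Set E)
    rw [h, finrank_top, Set.toFinset_singleton, Finset.card_singleton] at h1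
    omega
  obtain ⟨u, hu, hu0⟩ := Submodule.exists_mem_ne_zero_of_ne_bot hne
  have hvu : ⟪v, u⟫ = 0 := Submodule.mem_orthogonal_singleton_iff_inner_right.1 hu
  refine ⟨‖u‖⁻¹ • u, ?_, ?_⟩
  · rw [norm_smul, norm_inv, norm_norm, inv_mul_cancel₀ (norm_ne_zero_iff.2 hu0)]
  · rw [real_inner_smul_right, hvu, mul_zero]

/-- In dimension at least two, every vector has polar coordinates with respect to a given axis. -/
lemma exists_polar_decomposition {E : Type*} [NormedAddCommGroup E] [InnerProductSpace ℝ E]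
    [FiniteDimensional ℝ E] (hE : 2 ≤ Module.finrank ℝ E) {e y : E} (he : ‖e‖ = 1) (hy : y ≠ 0) :
    ∃ w : E, ‖w‖ = 1 ∧ ⟪e, w⟫ = 0 ∧
      y = ‖y‖ • (Real.cos (angle e y) • e + Real.sin (angle e y) • w) := by
  have hy' : ‖y‖ ≠ 0 := norm_ne_zero_iff.2 hy
  have hin : ⟪e, y⟫ = Real.cos (angle e y) * ‖y‖ := by
    rw [← cos_angle_mul_norm_mul_norm, he, one_mul]
  have hee : ⟪e, e⟫ = 1 := by rw [real_inner_self_eq_norm_sq, he, one_pow]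
  have hyy : ⟪y, y⟫ = ‖y‖ ^ 2 := real_inner_self_eq_norm_sq y
  have hye : ⟪y, e⟫ = Real.cos (angle e y) * ‖y‖ := by rw [real_inner_comm, hin]
  set c := Real.cos (angle e y)
  set σ := Real.sin (angle e y)
  have hcs : σ ^ 2 + c ^ 2 = 1 := Real.sin_sq_add_cos_sq _
  set z : E := ‖y‖⁻¹ • y - c • e with hz
  have hez : ⟪e, z⟫ = 0 := by
    rw [hz, inner_sub_right, real_inner_smul_right, real_inner_smul_right, hin, hee]
    field_simp
    ring
  have hzz : ‖z‖ ^ 2 = σ ^ 2 := by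
    rw [← real_inner_self_eq_norm_sq, hz]
    simp only [inner_sub_right, inner_sub_left, real_inner_smul_right, real_inner_smul_left,
      hin, hee, hyy, hye]
    field_simp
    linarith
  have hyz : y = ‖y‖ • (c • e + z) := by
    rw [hz, add_sub_cancel, smul_smul, mul_inv_cancel₀ hy', one_smul]
  by_cases hσ : σ = 0
  · obtain ⟨w, hw, hew⟩ := exists_unit_orthogonal hE e
    have hz0 : z = 0 := by
      rw [← norm_eq_zero, ← sq_eq_zero_iff, hzz, hσ]
      norm_num
    refine ⟨w, hw, hew, ?_⟩
    rw [hσ, zero_smul]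
    rwa [hz0] at hyz
  · refine ⟨σ⁻¹ • z, ?_, ?_, ?_⟩
    · rw [← sq_eq_sq₀ (norm_nonneg _) zero_le_one, norm_smul, mul_pow, hzz, Real.norm_eq_abs,
        sq_abs]
      field_simp
    · rw [real_inner_smul_right, hez, mul_zero]
    · rwa [smul_smul, mul_inv_cancel₀ hσ, one_smul]

lemma norm_smul_add_smul_sq {E : Type*} [NormedAddCommGroup E] [InnerProductSpace ℝ E]
    {e w : E} (he : ‖e‖ = 1) (hw : ‖w‖ = 1) (hew : ⟪e, w⟫ = 0) (a b : ℝ) :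
    ‖a • e + b • w‖ ^ 2 = a ^ 2 + b ^ 2 := by
  rw [norm_add_sq_real, real_inner_smul_left, real_inner_smul_right, hew, norm_smul, norm_smul,
    he, hw, Real.norm_eq_abs, Real.norm_eq_abs]
  simp

/-- The logarithmic spiral of radial speed `1` and angular speed `μ / (d + s)` in the plane of
`e` and `w`. -/
def logSpiral {E : Type*} [NormedAddCommGroup E] [NormedSpace ℝ E] (d μ : ℝ) (e w : E) (s : ℝ) :
    E :=
  ((d + s) * Real.cos (μ * Real.log ((d + s) / d))) • e +
    ((d + s) * Real.sin (μ * Real.log ((d + s) / d))) • w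

lemma norm_logSpiral {E : Type*} [NormedAddCommGroup E] [InnerProductSpace ℝ E]
    {e w : E} (he : ‖e‖ = 1) (hw : ‖w‖ = 1) (hew : ⟪e, w⟫ = 0) {d s : ℝ} (μ : ℝ)
    (hs : 0 ≤ d + s) : ‖logSpiral d μ e w s‖ = d + s := by
  rw [← sq_eq_sq₀ (norm_nonneg _) hs, logSpiral, norm_smul_add_smul_sq he hw hew, mul_pow, mul_pow,
    ← mul_add, Real.cos_sq_add_sin_sq, mul_one]

lemma lipschitzOnWith_logSpiral {E : Type*} [NormedAddCommGroup E] [InnerProductSpace ℝ E]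
    {e w : E} (he : ‖e‖ = 1) (hw : ‖w‖ = 1) (hew : ⟪e, w⟫ = 0) {d lam μ : ℝ} (hd : 0 < d)
    (hlam : 0 ≤ lam) (hμ : 1 + μ ^ 2 = lam ^ 2) (T : ℝ) :
    LipschitzOnWith (Real.toNNReal lam) (logSpiral d μ e w) (Set.Icc 0 T) := by
  set a : ℝ → ℝ := fun s => μ * Real.log ((d + s) / d) with ha
  have hderiv : ∀ s ∈ Set.Icc 0 T, HasDerivWithinAt (logSpiral d μ e w)
      ((Real.cos (a s) - μ * Real.sin (a s)) • e + (Real.sin (a s) + μ * Real.cos (a s)) • w)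
      (Set.Icc 0 T) s := by
    intro s hs
    have hds : d + s ≠ 0 := by linarith [hs.1]
    have h1 : HasDerivAt (fun s => d + s) 1 s := (hasDerivAt_id s).const_add d
    have h2 : HasDerivAt a (μ / (d + s)) s := by
      refine (((h1.div_const d).log (div_ne_zero hds hd.ne')).const_mul μ).congr_deriv ?_
      field_simp
    refine HasDerivAt.hasDerivWithinAt ?_
    refine HasDerivAt.congr_deriv
      (((h1.mul h2.cos).smul_const e).add ((h1.mul h2.sin).smul_const w)) ?_
    congr 2
    · field_simp
      ring
    · field_simp
  refine Convex.lipschitzOnWith_of_nnnorm_hasDerivWithin_le (convex_Icc 0 T) hderiv ?_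
  intro s _
  rw [← NNReal.coe_le_coe, coe_nnnorm, Real.coe_toNNReal _ hlam]
  refine le_of_eq ((sq_eq_sq₀ (norm_nonneg _) hlam).1 ?_)
  rw [norm_smul_add_smul_sq he hw hew, ← hμ]
  linear_combination (1 + μ ^ 2) * Real.sin_sq_add_cos_sq (a s)

lemma IsGrowthCompetition.dist_lt_of_mem_B_s12 {p q : M} {lam : ℝ} {A B : ℝ → Set M}
    (h : IsGrowthCompetition p q lam A B) {t : ℝ} (ht : 0 < t) {x : M} (hx : x ∈ B t) :
    dist x p < t := by
  rw [h.B_eq t ht] at hx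
  obtain ⟨η, ⟨h0, hL, -⟩, s, hs, rfl⟩ := hx
  have := hL.dist_le_mul s ⟨hs.1, hs.2.le⟩ 0 ⟨le_rfl, ht.le⟩
  rw [h0, NNReal.coe_one, one_mul, Real.dist_eq, sub_zero, abs_of_nonneg hs.1] at this
  exact this.trans_lt hs.2

/-- The faster set reaches the hypersurface swept out by logarithmic spirals by the time the
slower one could. -/
lemma IsGrowthCompetition.mem_A_of_norm_eq {E : Type*} [NormedAddCommGroup E]
    [InnerProductSpace ℝ E] [FiniteDimensional ℝ E] (hE : 2 ≤ Module.finrank ℝ E)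
    {p q : E} (hpq : p ≠ q) {lam μ : ℝ} (hlam : 0 ≤ lam) (hμ0 : 0 < μ) (hμ : 1 + μ ^ 2 = lam ^ 2)
    {A B : ℝ → Set E} (h : IsGrowthCompetition p q lam A B) {x : E}
    (hx : ‖x - p‖ = ‖q - p‖ * Real.exp (angle (q - p) (x - p) / μ)) {t : ℝ}
    (ht : ‖x - p‖ ≤ t) : x ∈ A t := by
  have hd : 0 < ‖q - p‖ := norm_pos_iff.2 (sub_ne_zero.2 hpq.symm)
  have hv : q - p = ‖q - p‖ • (‖q - p‖⁻¹ • (q - p)) := by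
    rw [smul_smul, mul_inv_cancel₀ hd.ne', one_smul]
  set d := ‖q - p‖ with hd_def
  set e := d⁻¹ • (q - p) with he_def
  have he : ‖e‖ = 1 := by
    rw [he_def, norm_smul, norm_inv, Real.norm_of_nonneg hd.le, ← hd_def, inv_mul_cancel₀ hd.ne']
  have hang : angle (q - p) (x - p) = angle e (x - p) :=
    (angle_smul_left_of_pos _ _ (inv_pos.2 hd)).symm
  rw [hang] at hx
  have hr : 0 < ‖x - p‖ := hx ▸ mul_pos hd (Real.exp_pos _)
  obtain ⟨w, hw, hew, hxw⟩ := exists_polar_decomposition hE he (norm_pos_iff.1 hr)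
  have hdr : d ≤ ‖x - p‖ := by
    rw [hx]
    exact le_mul_of_one_le_right hd.le
      (Real.one_le_exp (div_nonneg (angle_nonneg _ _) hμ0.le))
  have hlog : μ * Real.log (‖x - p‖ / d) = angle e (x - p) := by
    rw [hx, mul_div_cancel_left₀ _ hd.ne', Real.log_exp]
    field_simp
  have hstart : p + logSpiral d μ e w 0 = q := by
    simp only [logSpiral, add_zero, div_self hd.ne', Real.log_one, mul_zero, Real.cos_zero,
      Real.sin_zero, mul_one, zero_smul]
    rw [← hv]
    abel
  have hend : p + logSpiral d μ e w (‖x - p‖ - d) = x := by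
    simp only [logSpiral, add_sub_cancel, hlog]
    rw [mul_smul, mul_smul, ← smul_add, ← hxw]
    abel
  rcases hdr.eq_or_lt with heq | hlt
  · rw [← heq, sub_self, hstart] at hend
    subst hend
    exact h.monoA le_rfl (hr.le.trans ht) (h.A_zero ▸ Set.mem_singleton _)
  · have hT : 0 < ‖x - p‖ - d := sub_pos.2 hlt
    refine h.monoA hT.le (by linarith) ?_
    rw [h.A_eq _ hT]
    refine ⟨fun s => p + logSpiral d μ e w s, ⟨hstart, ?_, ?_⟩,
      ‖x - p‖ - d, ⟨hT.le, le_rfl⟩, hend⟩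
    · have hL := lipschitzOnWith_logSpiral he hw hew hd hlam hμ (‖x - p‖ - d)
      intro s hs s' hs'
      rw [edist_add_left]
      exact hL hs hs'
    · intro s hs hmem
      rcases hs.1.eq_or_lt with rfl | hs0
      · rw [h.B_zero] at hmem
        exact hpq (hmem.symm.trans hstart)
      · have hlt' := h.dist_lt_of_mem_B_s12 hs0 hmem
        rw [dist_eq_norm, add_sub_cancel_left,
          norm_logSpiral he hw hew μ (by linarith)] at hlt'
        linarith

/-- A path avoiding the faster set cannot cross the hypersurface of logarithmic spirals. -/
lemma IsGrowthCompetition.norm_sub_le_of_mem_B {E : Type*} [NormedAddCommGroup E]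
    [InnerProductSpace ℝ E] [FiniteDimensional ℝ E] (hE : 2 ≤ Module.finrank ℝ E)
    {p q : E} (hpq : p ≠ q) {lam μ : ℝ} (hlam : 0 ≤ lam) (hμ0 : 0 < μ) (hμ : 1 + μ ^ 2 = lam ^ 2)
    {A B : ℝ → Set E} (h : IsGrowthCompetition p q lam A B) {t : ℝ} (ht : 0 < t) {x : E}
    (hx : x ∈ B t) : ‖x - p‖ ≤ ‖q - p‖ * Real.exp (Real.pi / μ) := by
  have hd : 0 < ‖q - p‖ := norm_pos_iff.2 (sub_ne_zero.2 hpq.symm)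
  rw [h.B_eq t ht] at hx
  obtain ⟨η, ⟨h0, hL, hA⟩, s₀, hs₀, rfl⟩ := hx
  by_contra! hlt
  have hcont : ContinuousOn (fun s => ‖η s - p‖) (Set.Icc 0 s₀) :=
    ((hL.continuousOn.mono (Set.Icc_subset_Icc_right hs₀.2.le)).sub continuousOn_const).norm
  have hcompact : IsCompact (Set.Icc 0 s₀ ∩ (fun s => ‖η s - p‖) ⁻¹' Set.Iic ‖q - p‖) :=
    isCompact_Icc.of_isClosed_subset
      (hcont.preimage_isClosed_of_isClosed isClosed_Icc isClosed_Iic) Set.inter_subset_left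
  obtain ⟨s₁, ⟨hs₁, hle₁⟩, hmax⟩ := hcompact.exists_isGreatest
    ⟨0, ⟨le_rfl, hs₀.1⟩, by simp [h0]⟩
  set f : ℝ → ℝ := fun s => ‖q - p‖ * Real.exp (angle (q - p) (η s - p) / μ) with hf
  have hfge : ∀ s, ‖q - p‖ ≤ f s := fun s =>
    le_mul_of_one_le_right hd.le (Real.one_le_exp (div_nonneg (angle_nonneg _ _) hμ0.le))
  have hfle : f s₀ ≤ ‖q - p‖ * Real.exp (Real.pi / μ) := by
    simp only [hf]
    gcongr
    exact angle_le_pi _ _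
  have hsub : Set.Icc s₁ s₀ ⊆ Set.Icc 0 s₀ := Set.Icc_subset_Icc_left hs₁.1
  have hnorm₁ : ‖q - p‖ ≤ ‖η s₁ - p‖ := by
    by_contra! hlt₁
    have hqs₀ : ‖q - p‖ ≤ ‖η s₀ - p‖ := (hfge s₀).trans (hfle.trans hlt.le)
    obtain ⟨s, hs, hs'⟩ := intermediate_value_Icc hs₁.2 (hcont.mono hsub) ⟨hlt₁.le, hqs₀⟩
    have hss : s ≤ s₁ := hmax ⟨hsub hs, hs'.le⟩
    rw [le_antisymm hss hs.1] at hs'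
    exact hlt₁.ne hs'
  have hpos : ∀ s ∈ Set.Icc s₁ s₀, η s - p ≠ 0 := by
    intro s hs hzero
    have hle : s ≤ s₁ := hmax ⟨hsub hs, by simp [hzero]⟩
    rw [← le_antisymm hle hs.1, hzero, norm_zero] at hnorm₁
    linarith
  have hfcont : ContinuousOn f (Set.Icc s₁ s₀) := by
    intro s hs
    have hη : ContinuousWithinAt (fun s => η s - p) (Set.Icc s₁ s₀) s :=
      ((hL.continuousOn.mono ((Set.Icc_subset_Icc_right hs₀.2.le).trans' hsub)).sub
        continuousOn_const) s hs
    have hang := (continuousAt_angle (x := (q - p, η s - p)) (sub_ne_zero.2 hpq.symm)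
      (hpos s hs)).comp_continuousWithinAt (f := fun s => (q - p, η s - p))
      (continuousWithinAt_const.prodMk hη)
    exact continuousWithinAt_const.mul
      ((hang.div_const μ).rexp)
  obtain ⟨s, hs, hs'⟩ := intermediate_value_Icc hs₁.2 ((hcont.mono hsub).sub hfcont)
    (show (0 : ℝ) ∈ Set.Icc _ _ from
      ⟨sub_nonpos.2 (hle₁.trans (hfge s₁)), sub_nonneg.2 (hfle.trans hlt.le)⟩)
  have hs0 : 0 ≤ s := hs₁.1.trans hs.1
  have hst : s ∈ Set.Icc 0 t := ⟨hs0, hs.2.trans hs₀.2.le⟩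
  refine hA s hst (h.mem_A_of_norm_eq hE hpq hlam hμ0 hμ (sub_eq_zero.1 hs') ?_)
  have hdist := hL.dist_le_mul s hst 0 ⟨le_rfl, ht.le⟩
  rwa [h0, NNReal.coe_one, one_mul, Real.dist_eq, sub_zero, abs_of_nonneg hs0,
    dist_eq_norm] at hdist

/-- remark after Proposition 3.1.  For the growth
competition on Euclidean space `ℝⁿ` (`n ≥ 2`) between any two distinct
points `p, q` and any `λ > 1`, the set `B_∞` is bounded. -/
theorem euclidean_slower_set_bounded
    (n : ℕ) (hn : 2 ≤ n)
    (p q : EuclideanSpace ℝ (Fin n)) (hpq : p ≠ q)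
    (lam : ℝ) (hlam : 1 < lam)
    (A B : ℝ → Set (EuclideanSpace ℝ (Fin n)))
    (hcomp : IsGrowthCompetition p q lam A B) :
    Bornology.IsBounded (Binfty B) := by
  have hμ : 0 < lam ^ 2 - 1 := by nlinarith
  have hbound : ∀ t, 0 < t → ∀ x ∈ B t,
      ‖x - p‖ ≤ ‖q - p‖ * Real.exp (Real.pi / Real.sqrt (lam ^ 2 - 1)) := by
    intro t ht x hx
    refine hcomp.norm_sub_le_of_mem_B (by simpa using hn) hpq (by linarith)
      (Real.sqrt_pos.2 hμ) ?_ ht hx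
    rw [Real.sq_sqrt hμ.le]
    ring
  refine (Metric.isBounded_iff_subset_closedBall p).2
    ⟨‖q - p‖ * Real.exp (Real.pi / Real.sqrt (lam ^ 2 - 1)), ?_⟩
  intro x hx
  simp only [Binfty, Set.mem_iUnion, Set.mem_Ici] at hx
  obtain ⟨t, ht, hxt⟩ := hx
  rw [Metric.mem_closedBall, dist_eq_norm]
  exact hbound (t + 1) (by linarith) x (hcomp.monoB ht (by linarith) hxt)

end GrowthComp
end
end

section
/- Suppose the complete non-compact Riemannian manifold M is spherically symmetric about p, nonpositively curved, and satisfies I = ∫₁^∞ dr/G(r) < ∞. Then for every λ > 1 there exists L > 0 such that for every q with d(p,q) > L, the set B_∞ of the growth competition between p and q is unbounded. -/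
/-!
Formalization framework for "growth competitions" (after the paper's
Section 2), at the metric-space level.

Since Mathlib does not yet have Riemannian metrics, a complete Riemannian
manifold is represented by a proper (hence complete; Hopf-Rinow) metric
space whose distance is the induced length (intrinsic) metric, and
spherical symmetry about `p` with warping function `G` is expressed through
global geodesic polar normal coordinates `Φ : ℝⁿ ≃ M` with `Φ 0 = p` and
`dist (Φ x) p = ‖x‖`, in which the Riemannian distance is the infimum of
lengths of Lipschitz curves measured in the warped metric
`g = dr² + G(r)² dθ²`.
-/

open Set Metric Filter MeasureTheory InnerProductGeometry NNReal ENNReal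
open scoped RealInnerProductSpace Classical

noncomputable section

namespace GrowthComp

variable {M : Type*} [MetricSpace M]

lemma ofReal_sub_le_lintegral_deriv {f : ℝ → ℝ} {K : ℝ≥0} {a b : ℝ} (hab : a ≤ b)
    (hf : LipschitzOnWith K f (Icc a b)) :
    ENNReal.ofReal (f b - f a) ≤ ∫⁻ t in Icc a b, ENNReal.ofReal (deriv f t) := by
  have hac : AbsolutelyContinuousOnInterval f a b :=
    LipschitzOnWith.absolutelyContinuousOnInterval (by rwa [uIcc_of_le hab])
  rw [← hac.integral_deriv_eq_sub, intervalIntegral.integral_of_le hab,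
    ← integral_Icc_eq_integral_Ioc]
  have hint : IntegrableOn (deriv f) (Icc a b) := by
    rw [← intervalIntegrable_iff_integrableOn_Icc_of_le hab]
    exact hac.intervalIntegrable_deriv
  rw [integral_eq_lintegral_pos_part_sub_lintegral_neg_part hint]
  refine ENNReal.ofReal_le_of_le_toReal ?_
  simp

/-- The radial projection of `x` to the unit sphere. -/
def radialDir {n : ℕ} (x : Euc n) : Euc n := ‖x‖⁻¹ • x

lemma norm_radialDir {n : ℕ} {x : Euc n} (hx : x ≠ 0) : ‖radialDir x‖ = 1 := by
  simp [radialDir, norm_smul, hx]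

lemma norm_smul_radialDir {n : ℕ} (x : Euc n) : ‖x‖ • radialDir x = x := by
  by_cases hx : x = 0
  · simp [hx]
  · simp [radialDir, smul_smul, hx]

lemma radialDir_smul {n : ℕ} {e : Euc n} (he : ‖e‖ = 1) {s : ℝ} (hs : 0 < s) :
    radialDir (s • e) = e := by
  simp [radialDir, norm_smul, he, abs_of_pos hs, smul_smul, hs.ne']

lemma norm_radialDir_sub_le {n : ℕ} {r : ℝ} (hr : 0 < r) {x y : Euc n}
    (hx : r ≤ ‖x‖) (hy : r ≤ ‖y‖) :
    ‖radialDir x - radialDir y‖ ≤ 2 / r * ‖x - y‖ := by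
  have hx0 : 0 < ‖x‖ := hr.trans_le hx
  have hy0 : 0 < ‖y‖ := hr.trans_le hy
  have hdec : radialDir x - radialDir y =
      ‖x‖⁻¹ • ((x - y) + (‖y‖ - ‖x‖) • radialDir y) := by
    have := norm_smul_radialDir y
    rw [sub_smul, this, smul_add, smul_sub, smul_sub, smul_smul ‖x‖⁻¹ ‖x‖,
      inv_mul_cancel₀ hx0.ne', one_smul, radialDir]
    abel
  have hbr : ‖(x - y) + (‖y‖ - ‖x‖) • radialDir y‖ ≤ 2 * ‖x - y‖ := by
    refine (norm_add_le _ _).trans ?_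
    rw [norm_smul, norm_radialDir (norm_pos_iff.mp hy0), mul_one, Real.norm_eq_abs]
    have := abs_norm_sub_norm_le y x
    rw [norm_sub_rev] at this
    linarith
  rw [hdec, norm_smul, norm_inv, norm_norm, div_mul_eq_mul_div, inv_mul_eq_div]
  gcongr

lemma norm_tangential_sq {n : ℕ} {e : Euc n} (he : ‖e‖ = 1) (v : Euc n) :
    ‖v - ⟪v, e⟫ • e‖ ^ 2 = ‖v‖ ^ 2 - ⟪v, e⟫ ^ 2 := by
  rw [norm_sub_sq_real, norm_smul, he, real_inner_smul_right, mul_one, Real.norm_eq_abs, sq_abs]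
  ring

lemma mul_norm_tangential_le_warpNorm {n : ℕ} {G : ℝ → ℝ} {x : Euc n} (hx : x ≠ 0)
    (v : Euc n) :
    G ‖x‖ / ‖x‖ * ‖v - ⟪v, radialDir x⟫ • radialDir x‖ ≤ warpNorm G x v := by
  rw [warpNorm, if_neg hx]
  refine Real.le_sqrt_of_sq_le ?_
  rw [mul_pow, norm_tangential_sq (norm_radialDir hx)]
  have := sq_nonneg ⟪v, radialDir x⟫
  simp only [radialDir] at this ⊢
  linarith

lemma hasDerivAt_inner_radialDir {n : ℕ} {c : ℝ → Euc n} {v : Euc n} {t : ℝ}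
    (hc : HasDerivAt c v t) (h0 : c t ≠ 0) (w : Euc n) :
    HasDerivAt (fun s => ⟪radialDir (c s), w⟫)
      (‖c t‖⁻¹ * ⟪v - ⟪v, radialDir (c t)⟫ • radialDir (c t), w⟫) t := by
  have hn : 0 < ‖c t‖ := norm_pos_iff.mpr h0
  have hnorm : HasDerivAt (fun s => ‖c s‖) (⟪v, radialDir (c t)⟫) t := by
    have h1 := (hc.norm_sq).sqrt (by positivity)
    simp only [Real.sqrt_sq (norm_nonneg _)] at h1
    convert h1 using 1
    rw [radialDir, real_inner_smul_right, real_inner_comm]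
    field_simp
  have h2 := (hnorm.inv hn.ne').mul (hc.inner ℝ (hasDerivAt_const t w))
  have h3 : (fun s => ⟪radialDir (c s), w⟫) = fun s => (‖c s‖⁻¹) * ⟪c s, w⟫ := by
    funext s
    rw [radialDir, real_inner_smul_left]
  rw [h3]
  refine h2.congr_deriv ?_
  simp only [radialDir, inner_sub_left, real_inner_smul_left, real_inner_smul_right,
    inner_zero_right, Pi.inv_apply]
  field_simp
  ring

lemma ofReal_mul_norm_sub_le_warpLength {n : ℕ} {G : ℝ → ℝ} {r : ℝ} (hr : 0 < r)
    (hpos : ∀ s, 0 < s → 0 < G s) (hmono : MonotoneOn G (Ioi 0))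
    {c : ℝ → Euc n} {T : ℝ} (hT : 0 ≤ T) {K : ℝ≥0} (hc : LipschitzOnWith K c (Icc 0 T))
    (hcr : ∀ t ∈ Icc 0 T, r ≤ ‖c t‖) :
    ENNReal.ofReal (G r * ‖radialDir (c T) - radialDir (c 0)‖) ≤ warpLength G c T := by
  set w := radialDir (radialDir (c T) - radialDir (c 0)) with hw
  by_cases h0 : radialDir (c T) - radialDir (c 0) = 0
  · simp [h0]
  have hw1 : ‖w‖ = 1 := norm_radialDir h0
  have hGr := hpos r hr
  set f : ℝ → ℝ := fun s => G r * ⟪radialDir (c s), w⟫ with hfdef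
  have hlip : LipschitzOnWith (Real.toNNReal (G r * (2 / r * K))) f (Icc 0 T) := by
    refine LipschitzOnWith.of_dist_le_mul fun s hs t ht => ?_
    rw [Real.coe_toNNReal _ (by positivity), hfdef, Real.dist_eq, ← mul_sub, ← inner_sub_left,
      abs_mul, abs_of_pos hGr, mul_assoc]
    gcongr
    calc |⟪radialDir (c s) - radialDir (c t), w⟫|
        ≤ ‖radialDir (c s) - radialDir (c t)‖ * ‖w‖ := abs_real_inner_le_norm _ _
      _ ≤ 2 / r * ‖c s - c t‖ := by
          rw [hw1, mul_one]
          exact norm_radialDir_sub_le hr (hcr s hs) (hcr t ht)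
      _ ≤ 2 / r * (K * dist s t) := by
          rw [← dist_eq_norm]
          gcongr
          exact hc.dist_le_mul s hs t ht
      _ = _ := by ring
  have hfT : f T - f 0 = G r * ‖radialDir (c T) - radialDir (c 0)‖ := by
    simp only [hfdef]
    rw [← mul_sub, ← inner_sub_left, hw]
    nth_rewrite 1 [← norm_smul_radialDir (radialDir (c T) - radialDir (c 0))]
    rw [real_inner_smul_left, real_inner_self_eq_norm_sq, ← hw, hw1, one_pow, mul_one]
  rw [← hfT]
  refine (ofReal_sub_le_lintegral_deriv hT hlip).trans (lintegral_mono_ae ?_)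
  rw [ae_restrict_iff' measurableSet_Icc]
  have hne0 : ∀ᵐ t : ℝ, t ≠ 0 := by simp [ae_iff, measure_singleton]
  have hneT : ∀ᵐ t : ℝ, t ≠ T := by simp [ae_iff, measure_singleton]
  filter_upwards [hc.ae_differentiableWithinAt_of_mem_real, hne0, hneT] with t hd ht0 htT ht
  have hdt : HasDerivAt c (deriv c t) t := ((hd ht).differentiableAt
    (Icc_mem_nhds (lt_of_le_of_ne ht.1 ht0.symm) (lt_of_le_of_ne ht.2 htT))).hasDerivAt
  have hct : 0 < ‖c t‖ := hr.trans_le (hcr t ht)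
  have hct0 := norm_pos_iff.mp hct
  have hGG : G r ≤ G ‖c t‖ := hmono hr hct (hcr t ht)
  rw [hfdef, ((hasDerivAt_inner_radialDir hdt hct0 w).const_mul (G r)).deriv]
  refine ENNReal.ofReal_le_ofReal ?_
  refine le_trans ?_ (mul_norm_tangential_le_warpNorm hct0 _)
  have hcs := real_inner_le_norm (deriv c t - ⟪deriv c t, radialDir (c t)⟫ • radialDir (c t)) w
  rw [hw1, mul_one] at hcs
  rw [div_mul_eq_mul_div, mul_left_comm, inv_mul_eq_div]
  gcongr ?_ / _
  exact (mul_le_mul_of_nonneg_left hcs hGr.le).trans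
    (mul_le_mul_of_nonneg_right hGG (norm_nonneg _))

variable {n : ℕ} {p : M} {G : ℝ → ℝ} {Φ : Euc n ≃ M}

lemma IsSphericallySymmetric.dist_le_of_warpLength (h : IsSphericallySymmetric p G Φ)
    {c : ℝ → Euc n} {T ℓ : ℝ} (hT : 0 ≤ T) (hℓ : 0 ≤ ℓ) {K : ℝ≥0}
    (hc : LipschitzOnWith K c (Icc 0 T)) (hlen : warpLength G c T ≤ ENNReal.ofReal ℓ) :
    dist (Φ (c 0)) (Φ (c T)) ≤ ℓ := by
  rw [← ENNReal.ofReal_le_ofReal_iff hℓ, h.2.2.2]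
  refine le_trans (sInf_le ?_) hlen
  exact ⟨T, c, hT, rfl, rfl, ⟨K, hc⟩, rfl⟩

lemma IsSphericallySymmetric.abs_norm_sub_norm_le (h : IsSphericallySymmetric p G Φ)
    (x y : Euc n) : |‖x‖ - ‖y‖| ≤ dist (Φ x) (Φ y) := by
  rw [← h.2.2.1 x, ← h.2.2.1 y]
  exact abs_dist_sub_le _ _ _

lemma IsSphericallySymmetric.mul_norm_radialDir_sub_le (h : IsSphericallySymmetric p G Φ)
    (hmono : MonotoneOn G (Ioi 0)) {x y : Euc n} {r : ℝ} (hr : 0 < r)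
    (hx : r + dist (Φ x) (Φ y) < ‖x‖) :
    G r * ‖radialDir y - radialDir x‖ ≤ dist (Φ x) (Φ y) := by
  by_contra! hcon
  obtain ⟨ℓ, hℓ1, hℓ2⟩ := exists_between (lt_min hcon (lt_sub_iff_add_lt'.mpr hx))
  have hℓ0 : 0 ≤ ℓ := dist_nonneg.trans hℓ1.le
  have hlt : ENNReal.ofReal (dist (Φ x) (Φ y)) < ENNReal.ofReal ℓ :=
    (ENNReal.ofReal_lt_ofReal_iff_of_nonneg dist_nonneg).mpr hℓ1
  rw [h.2.2.2, sInf_lt_iff] at hlt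
  obtain ⟨L, ⟨T, c, hT, rfl, rfl, ⟨K, hc⟩, rfl⟩, hL⟩ := hlt
  have hcr : ∀ t ∈ Icc 0 T, r ≤ ‖c t‖ := by
    intro t ht
    have hd : dist (Φ (c 0)) (Φ (c t)) ≤ ℓ := by
      refine h.dist_le_of_warpLength ht.1 hℓ0 (hc.mono (Icc_subset_Icc_right ht.2)) ?_
      exact (lintegral_mono_set (Icc_subset_Icc_right ht.2)).trans hL.le
    have h1 := (le_abs_self _).trans (h.abs_norm_sub_norm_le (c 0) (c t))
    have h2 := hℓ2.trans_le (min_le_right _ _)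
    linarith
  have h3 := (ofReal_mul_norm_sub_le_warpLength hr h.1.1 hmono hT hc hcr).trans hL.le
  rw [ENNReal.ofReal_le_ofReal_iff hℓ0] at h3
  exact absurd (hℓ2.trans_le (min_le_left _ _)) h3.not_gt

lemma IsSphericallySymmetric.dist_smul_le (h : IsSphericallySymmetric p G Φ)
    {e : Euc n} (he : ‖e‖ = 1) (s t : ℝ) : dist (Φ (s • e)) (Φ (t • e)) ≤ |s - t| := by
  wlog hst : s ≤ t generalizing s t
  · rw [dist_comm, abs_sub_comm]
    exact this t s (le_of_not_ge hst)
  set c : ℝ → Euc n := fun v => (s + v) • e with hc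
  have hder : ∀ v, HasDerivAt c e v := fun v => by
    simpa using ((hasDerivAt_id v).const_add s).smul_const e
  have hlip : LipschitzOnWith 1 c (Icc 0 (t - s)) := by
    refine LipschitzOnWith.of_dist_le_mul fun a _ b _ => ?_
    simp [hc, dist_eq_norm, ← sub_smul, norm_smul, he]
  have hnorm : ∀ v, warpNorm G (c v) (deriv c v) = 1 := by
    intro v
    rw [(hder v).deriv, warpNorm]
    split_ifs with h0
    · exact he
    · have hsv : s + v ≠ 0 := fun h1 => h0 (by simp [hc, h1])
      have hin : ⟪e, ‖c v‖⁻¹ • c v⟫ ^ 2 = 1 := by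
        simp only [hc, norm_smul, he, mul_one, real_inner_smul_right, real_inner_self_eq_norm_sq,
          Real.norm_eq_abs, one_pow, mul_pow, inv_pow, sq_abs]
        field_simp
      simp [hin, he]
  have hlen : warpLength G c (t - s) ≤ ENNReal.ofReal (t - s) := by
    simp [warpLength, hnorm]
  have := h.dist_le_of_warpLength (sub_nonneg.mpr hst) (sub_nonneg.mpr hst) hlip hlen
  simp only [hc, add_zero, add_sub_cancel] at this
  rwa [abs_sub_comm, abs_of_nonneg (sub_nonneg.mpr hst)]

lemma exists_small_primitive {G : ℝ → ℝ} (hpos : ∀ s, 0 < s → 0 < G s)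
    (hmono : MonotoneOn G (Ioi 0)) (hcont : ContinuousOn G (Ioi 0))
    (hhyp : HyperbolicWarping G) {ε : ℝ} (hε : 0 < ε) :
    ∃ m₀ : ℝ, 0 < m₀ ∧ ∀ m, m₀ ≤ m → ∃ F : ℝ → ℝ, Continuous F ∧ F 0 = 0 ∧
      (∀ a b, a ≤ b → F a ≤ F b) ∧ (∀ a b, a ≤ b → (b - a) / G (max b m) ≤ F b - F a) ∧
      ∀ w, F w ≤ ε := by
  set g : ℝ → ℝ := fun x => (G x)⁻¹ with hg
  have hgc : ContinuousOn g (Ioi 0) := hcont.inv₀ fun x hx => (hpos x hx).ne'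
  have hgi : ∀ a b, 0 < a → 0 < b → IntervalIntegrable g volume a b := fun a b ha hb =>
    (hgc.mono fun x hx => (lt_min ha hb).trans_le hx.1).intervalIntegrable
  have hint : IntegrableOn g (Ioi 1) := by
    have hmeas : AEStronglyMeasurable g (volume.restrict (Ioi 1)) :=
      (hgc.mono (Ioi_subset_Ioi zero_le_one)).aestronglyMeasurable measurableSet_Ioi
    refine ⟨hmeas, ?_⟩
    rw [hasFiniteIntegral_iff_ofReal]
    · exact (lintegral_mono_set Ioi_subset_Ici_self).trans_lt hhyp
    · refine (ae_restrict_iff' measurableSet_Ioi).2 (ae_of_all _ fun x hx => ?_)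
      exact inv_nonneg.mpr (hpos x (zero_lt_one.trans hx)).le
  have htail : ∃ N : ℝ, 1 ≤ N ∧ ∀ a b, N ≤ a → N ≤ b → ∫ x in a..b, g x ≤ ε / 3 := by
    have htend := intervalIntegral_tendsto_integral_Ioi 1 hint tendsto_id
    obtain ⟨N, hN⟩ := (Metric.tendsto_atTop.mp htend) (ε / 6) (by positivity)
    refine ⟨max N 1, le_max_right _ _, fun a b ha hb => ?_⟩
    have ha' := hN a ((le_max_left _ _).trans ha)
    have hb' := hN b ((le_max_left _ _).trans hb)
    have ha1 : 0 < a := zero_lt_one.trans_le ((le_max_right _ _).trans ha)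
    have hb1 : 0 < b := zero_lt_one.trans_le ((le_max_right _ _).trans hb)
    rw [Real.dist_eq, abs_lt] at ha' hb'
    have := intervalIntegral.integral_add_adjacent_intervals
      (hgi 1 a one_pos ha1) (hgi a b ha1 hb1)
    simp only [id] at ha' hb'
    linarith
  obtain ⟨N, hN1, hN⟩ := htail
  refine ⟨2 * N, by linarith, fun m hm => ?_⟩
  have hm0 : 0 < m := by linarith
  have hmax : ∀ x, 0 < max x m := fun x => hm0.trans_le (le_max_right _ _)
  set k : ℝ → ℝ := fun x => (G (max x m))⁻¹ with hk
  have hkc : Continuous k :=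
    (hcont.comp_continuous (by fun_prop) hmax).inv₀ fun x => (hpos _ (hmax x)).ne'
  have hki : ∀ a b, IntervalIntegrable k volume a b := fun a b => hkc.intervalIntegrable a b
  have hk0 : ∀ x, 0 < k x := fun x => inv_pos.mpr (hpos _ (hmax x))
  set F : ℝ → ℝ := fun w => ∫ x in (0 : ℝ)..w, k x with hF
  have hsub : ∀ a b, F b - F a = ∫ x in a..b, k x := fun a b =>
    intervalIntegral.integral_interval_sub_left (hki 0 b) (hki 0 a)
  have hFm : ∀ a b, a ≤ b → F a ≤ F b := fun a b hab => by
    rw [← sub_nonneg, hsub]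
    exact intervalIntegral.integral_nonneg hab fun x _ => (hk0 x).le
  refine ⟨F, intervalIntegral.continuous_primitive hki 0, intervalIntegral.integral_same, hFm,
    fun a b hab => ?_, fun w => ?_⟩
  · rw [hsub]
    calc (b - a) / G (max b m) = ∫ _x in a..b, (G (max b m))⁻¹ := by
          simp [div_eq_mul_inv]
      _ ≤ ∫ x in a..b, k x :=
          intervalIntegral.integral_mono_on hab intervalIntegrable_const (hki a b) fun x hx =>
            inv_anti₀ (hpos _ (hmax x))
              (hmono (hmax x) (hmax b) (max_le_max_right m hx.2))
  · refine (hFm w _ (le_max_left w m)).trans ?_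
    have hwm : m ≤ max w m := le_max_right _ _
    have h1 : F (max w m) - F m ≤ ε / 3 := by
      rw [hsub]
      refine le_trans (le_of_eq (intervalIntegral.integral_congr fun x hx => ?_))
        (hN m (max w m) (by linarith) (by linarith))
      rw [uIcc_of_le hwm] at hx
      simp only [hk, hg, max_eq_left hx.1]
    have h2 : F m = m / G m := by
      have : F m = ∫ _x in (0 : ℝ)..m, (G m)⁻¹ := by
        refine intervalIntegral.integral_congr fun x hx => ?_
        rw [uIcc_of_le hm0.le] at hx
        simp only [hk, max_eq_right hx.2]
      rw [this]
      simp [div_eq_mul_inv]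
    have h3 : m / G m ≤ 2 * (ε / 3) := by
      have : (m - m / 2) * (G m)⁻¹ ≤ ∫ x in (m / 2)..m, g x := by
        calc (m - m / 2) * (G m)⁻¹ = ∫ _x in (m / 2)..m, (G m)⁻¹ := by simp
          _ ≤ ∫ x in (m / 2)..m, g x := by
            refine intervalIntegral.integral_mono_on (by linarith) intervalIntegrable_const
              (hgi _ _ (by linarith) hm0) fun x hx => ?_
            have hx0 : 0 < x := by linarith [hx.1]
            exact inv_anti₀ (hpos _ hx0) (hmono hx0 hm0 hx.2)
      have h4 := hN (m / 2) m (by linarith) (by linarith)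
      rw [div_eq_mul_inv]
      linarith
    linarith

lemma sub_le_sub_of_local {f g : ℝ → ℝ} {a b δ : ℝ} (hδ : 0 < δ) (hab : a ≤ b)
    (h : ∀ v w, a ≤ v → v ≤ w → w ≤ b → w - v ≤ δ → f w - f v ≤ g w - g v) :
    f b - f a ≤ g b - g a := by
  have key : ∀ (k : ℕ) (c : ℝ), a ≤ c → c ≤ b → c - a ≤ k * δ → f c - f a ≤ g c - g a := by
    intro k
    induction k with
    | zero =>
      intro c hac _ hck
      have : c = a := le_antisymm (by simpa using hck) hac
      simp [this]
    | succ k ih =>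
      intro c hac hcb hck
      push_cast at hck
      rcases le_total (c - δ) a with hc | hc
      · exact h a c le_rfl hac hcb (by linarith)
      · have h1 := ih (c - δ) hc (by linarith) (by linarith)
        have h2 := h (c - δ) c hc (by linarith) hcb (by linarith)
        linarith
  obtain ⟨k, hk⟩ := exists_nat_ge ((b - a) / δ)
  exact key k b hab le_rfl ((div_le_iff₀ hδ).mp hk)

lemma IsSphericallySymmetric.norm_radialDir_sub_le_add (h : IsSphericallySymmetric p G Φ)
    (hmono : MonotoneOn G (Ioi 0)) {m lam : ℝ} (hm : 0 < m) (hlam : 0 < lam) {F : ℝ → ℝ}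
    (hF : ∀ a b, a ≤ b → (b - a) / G (max b m) ≤ F b - F a)
    {γ : ℝ → M} {T s u : ℝ} (hγ : LipschitzOnWith (Real.toNNReal lam) γ (Icc 0 T))
    (hs : 0 ≤ s) (hsu : s ≤ u) (huT : u ≤ T)
    (hfar : ∀ v ∈ Ioc s u, 2 * max (v / 4) m ≤ ‖Φ.symm (γ v)‖) (e : Euc n) :
    ‖radialDir (Φ.symm (γ u)) - e‖ ≤
      ‖radialDir (Φ.symm (γ s)) - e‖ + 4 * lam * (F (u / 4) - F (s / 4)) := by
  have key := sub_le_sub_of_local (f := fun v => ‖radialDir (Φ.symm (γ v)) - e‖)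
    (g := fun v => 4 * lam * F (v / 4)) (δ := m / (2 * lam)) (by positivity) hsu ?_
  · linarith
  intro v w hv hvw hw hwv
  rcases hvw.eq_or_lt with rfl | hlt
  · simp
  set r := max (w / 4) m with hr
  have hr0 : 0 < r := hm.trans_le (le_max_right _ _)
  have hd : dist (γ w) (γ v) ≤ lam * (w - v) := by
    have := hγ.dist_le_mul w ⟨by linarith, by linarith⟩ v ⟨by linarith, by linarith⟩
    rwa [Real.coe_toNNReal _ hlam.le, Real.dist_eq, abs_of_nonneg (by linarith)] at this
  have hsmall : lam * (w - v) ≤ m / 2 := by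
    rw [le_div_iff₀ (by positivity)] at hwv
    linarith
  have hdir := h.mul_norm_radialDir_sub_le hmono (x := Φ.symm (γ w)) (y := Φ.symm (γ v)) hr0 (by
    rw [Φ.apply_symm_apply, Φ.apply_symm_apply]
    have h1 := hfar w ⟨by linarith, hw⟩
    have h2 : m ≤ r := le_max_right _ _
    linarith)
  rw [Φ.apply_symm_apply, Φ.apply_symm_apply] at hdir
  have hGr : 0 < G r := h.1.1 r hr0
  have hFs := hF (v / 4) (w / 4) (by linarith)
  rw [div_le_iff₀ hGr] at hFs
  have htri := norm_sub_le_norm_sub_add_norm_sub (radialDir (Φ.symm (γ w)))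
    (radialDir (Φ.symm (γ v))) e
  rw [norm_sub_rev (radialDir (Φ.symm (γ w))) (radialDir (Φ.symm (γ v)))] at htri
  have hfin : ‖radialDir (Φ.symm (γ v)) - radialDir (Φ.symm (γ w))‖ ≤
      4 * lam * (F (w / 4) - F (v / 4)) := by
    refine le_of_mul_le_mul_left (hdir.trans (hd.trans ?_)) hGr
    have := mul_le_mul_of_nonneg_left hFs hlam.le
    linarith
  linarith

lemma IsSphericallySymmetric.smul_mem_B (h : IsSphericallySymmetric p G Φ) {q : M} {lam : ℝ}
    {A B : ℝ → Set M} (hAB : IsGrowthCompetition p q lam A B) {e : Euc n} (he : ‖e‖ = 1)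
    {s t : ℝ} (hs : 0 ≤ s) (hst : s < t) (hA : ∀ v ∈ Icc 0 t, Φ (v • e) ∉ A v) :
    Φ (s • e) ∈ B t := by
  rw [hAB.B_eq t (hs.trans_lt hst)]
  refine ⟨fun v => Φ (v • e), ⟨by simp [h.2.1], ?_, hA⟩, s, ⟨hs, hst⟩, rfl⟩
  refine LipschitzOnWith.of_dist_le_mul fun a _ b _ => ?_
  simpa [Real.dist_eq] using h.dist_smul_le he a b

/-- A region with a radial profile: the ball of radius `R` together with the directions whose
chordal distance to `e₀` exceeds `ψ` of the radius. -/
def ShadowRegion (R : ℝ) (ψ : ℝ → ℝ) (e₀ e : Euc n) : Set ℝ := {s | s < R ∨ ψ s < ‖e - e₀‖}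

lemma IsSphericallySymmetric.shadow_mem_B (h : IsSphericallySymmetric p G Φ) {q : M} {lam : ℝ}
    {A B : ℝ → Set M} (hAB : IsGrowthCompetition p q lam A B) {R T : ℝ} {ψ : ℝ → ℝ}
    (hψc : Continuous ψ) (hψm : Monotone ψ) {e₀ : Euc n}
    (hT : ∀ e : Euc n, ‖e‖ = 1 → ∀ s ∈ ShadowRegion R ψ e₀ e, 0 ≤ s → s ≤ T →
      Φ (s • e) ∉ A s)
    {e : Euc n} (he : ‖e‖ = 1) {s t : ℝ} (hse : s ∈ ShadowRegion R ψ e₀ e) (hs : 0 ≤ s)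
    (hst : s < t) (htT : t ≤ T) : Φ (s • e) ∈ B t := by
  have hopen : IsOpen (ShadowRegion R ψ e₀ e) :=
    (isOpen_lt continuous_id continuous_const).union (isOpen_lt hψc continuous_const)
  have hev : ∀ᶠ t' in nhdsWithin s (Ioi s), t' ∈ ShadowRegion R ψ e₀ e ∧ t' ∈ Ioc s t :=
    Filter.inter_mem (mem_nhdsWithin_of_mem_nhds (hopen.mem_nhds hse)) (Ioc_mem_nhdsGT hst)
  obtain ⟨t', ht', hst', ht't⟩ := hev.exists
  refine hAB.monoB (hs.trans hst'.le) ht't (h.smul_mem_B hAB he hs hst' fun v hv => ?_)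
  refine hT e he v ?_ hv.1 (hv.2.trans (ht't.trans htT))
  exact ht'.imp (fun h1 => hv.2.trans_lt h1) fun h1 => (hψm hv.2).trans_lt h1

lemma IsSphericallySymmetric.notMem_A_of_shadow (h : IsSphericallySymmetric p G Φ)
    (hmono : MonotoneOn G (Ioi 0)) {q : M} {lam : ℝ} (hlam : 0 < lam)
    {A B : ℝ → Set M} (hAB : IsGrowthCompetition p q lam A B) {m : ℝ} (hm : 0 < m)
    {F : ℝ → ℝ} (hFc : Continuous F) (hF0 : F 0 = 0) (hFm : Monotone F)
    (hF : ∀ a b, a ≤ b → (b - a) / G (max b m) ≤ F b - F a)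
    (hD : 2 * m * (lam + 2) ≤ dist p q) {e : Euc n} (he : ‖e‖ = 1) {s : ℝ} (hs : 0 ≤ s)
    (hse : s ∈ ShadowRegion (2 * m) (fun r => 4 * lam * F (r / 2)) (radialDir (Φ.symm q)) e) :
    Φ (s • e) ∉ A s := by
  set ψ : ℝ → ℝ := fun r => 4 * lam * F (r / 2) with hψ
  set e₀ := radialDir (Φ.symm q) with he₀
  have hψc : Continuous ψ := by fun_prop
  have hψm : Monotone ψ := fun a b hab =>
    mul_le_mul_of_nonneg_left (hFm (by linarith)) (by positivity)
  have hnorm : ∀ x : M, ‖Φ.symm x‖ = dist x p := fun x => by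
    rw [← h.2.2.1, Φ.apply_symm_apply]
  have hgo : ∀ {T : ℝ} {γ : ℝ → M}, AvoidsB q lam B T γ → ∀ u ∈ Icc 0 T,
      dist p q - lam * u ≤ ‖Φ.symm (γ u)‖ := by
    intro T γ hγ u hu
    have h1 := hγ.2.1.dist_le_mul u hu 0 ⟨le_rfl, hu.1.trans hu.2⟩
    rw [hγ.1, Real.coe_toNNReal _ hlam.le, Real.dist_eq, sub_zero, abs_of_nonneg hu.1] at h1
    have h2 := dist_triangle_left p q (γ u)
    rw [hnorm]
    linarith
  have hbase : ∀ e : Euc n, ‖e‖ = 1 → ∀ s, 0 ≤ s → s ≤ 2 * m → Φ (s • e) ∉ A s := by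
    intro e he s hs hsR hmem
    have hDpos : 0 < dist p q := lt_of_lt_of_le (by positivity) hD
    rcases hs.eq_or_lt with rfl | hs0
    · rw [hAB.A_zero, zero_smul, h.2.1, mem_singleton_iff] at hmem
      exact (dist_pos.mp hDpos) hmem
    rw [hAB.A_eq s hs0] at hmem
    obtain ⟨γ, hγ, u, hu, hx⟩ := hmem
    have h1 := hgo hγ u hu
    rw [hx, Φ.symm_apply_apply, norm_smul, he, mul_one, Real.norm_eq_abs, abs_of_nonneg hs] at h1
    have := mul_le_mul_of_nonneg_left (hu.2.trans hsR) hlam.le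
    linarith
  have hball : ∀ {T : ℝ} {γ : ℝ → M}, AvoidsB q lam B T γ → ∀ v ∈ Icc 0 T,
      2 * m ≤ ‖Φ.symm (γ v)‖ := by
    intro T γ hγ v hv
    by_contra! hlt
    rcases le_total v (2 * m) with hvm | hvm
    · have h1 := hgo hγ v hv
      have := mul_le_mul_of_nonneg_left hvm hlam.le
      linarith
    · have hx : ∃ e : Euc n, ‖e‖ = 1 ∧ ‖Φ.symm (γ v)‖ • e = Φ.symm (γ v) := by
        by_cases h0 : Φ.symm (γ v) = 0
        · exact ⟨_, he, by simp [h0]⟩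
        · exact ⟨_, norm_radialDir h0, norm_smul_radialDir _⟩
      obtain ⟨e', he', hx⟩ := hx
      have hB := h.smul_mem_B hAB he' (norm_nonneg _) hlt
        fun w hw => hbase e' he' w hw.1 hw.2
      rw [hx, Φ.apply_symm_apply] at hB
      exact hγ.2.2 v hv (hAB.monoB (by positivity) hvm hB)
  have key : ∀ k : ℕ, ∀ e : Euc n, ‖e‖ = 1 → ∀ s ∈ ShadowRegion (2 * m) ψ e₀ e, 0 ≤ s →
      s ≤ 2 * m + k * m → Φ (s • e) ∉ A s := by
    intro k
    induction k with
    | zero =>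
      intro e he s _ hs hsR
      exact hbase e he s hs (by simpa using hsR)
    | succ k ih =>
      intro e he s hse hs hsT hmem
      push_cast at hsT
      have hkm : 0 ≤ k * m := by positivity
      rcases le_or_gt s (2 * m) with hsm | hsm
      · exact hbase e he s hs hsm hmem
      have hs0 : 0 < s := by linarith
      rw [hAB.A_eq s hs0] at hmem
      obtain ⟨γ, hγ, u, hu, hx⟩ := hmem
      have hsymm : Φ.symm (γ u) = s • e := by rw [hx, Φ.symm_apply_apply]
      have hcn : ContinuousOn (fun v => dist (γ v) p - v / 2) (Icc 0 u) :=
        ContinuousOn.sub (fun v hv => (hγ.2.1.continuousOn.mono (Icc_subset_Icc_right hu.2)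
          v hv).dist tendsto_const_nhds) (by fun_prop)
      obtain ⟨a, ha0, hau, hchord, hfar⟩ : ∃ a, 0 ≤ a ∧ a ≤ u ∧
          ‖radialDir (Φ.symm (γ a)) - e₀‖ ≤ 4 * lam * F (a / 4) ∧
          ∀ v ∈ Ioc a u, v / 2 < ‖Φ.symm (γ v)‖ := by
        set S := Icc 0 u ∩ (fun v => dist (γ v) p - v / 2) ⁻¹' Iic 0 with hS
        have hScomp : IsCompact S :=
          isCompact_Icc.of_isClosed_subset (hcn.preimage_isClosed_of_isClosed isClosed_Icc
            isClosed_Iic) inter_subset_left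
        rcases S.eq_empty_or_nonempty with hSe | hSne
        · refine ⟨0, le_rfl, hu.1, by simp [hγ.1, he₀, hF0], fun v hv => ?_⟩
          by_contra! hcon
          have : v ∈ S := ⟨⟨hv.1.le, hv.2⟩, by
            rw [hnorm] at hcon
            simpa using hcon⟩
          simp [hSe] at this
        · obtain ⟨a, haS, hamax⟩ := hScomp.exists_isGreatest hSne
          have haT : a ∈ Icc 0 s := ⟨haS.1.1, haS.1.2.trans hu.2⟩
          have har : ‖Φ.symm (γ a)‖ ≤ a / 2 := by
            rw [hnorm]
            simpa using haS.2
          refine ⟨a, haS.1.1, haS.1.2, ?_, fun v hv => ?_⟩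
          · have hρ := hball hγ a haT
            have hne : Φ.symm (γ a) ≠ 0 := norm_pos_iff.mp (by linarith)
            by_contra! hcon
            have hmemS : ‖Φ.symm (γ a)‖ ∈
                ShadowRegion (2 * m) ψ e₀ (radialDir (Φ.symm (γ a))) := by
              refine Or.inr (lt_of_le_of_lt ?_ hcon)
              exact mul_le_mul_of_nonneg_left (hFm (by linarith)) (by positivity)
            have hB := h.shadow_mem_B hAB hψc hψm ih (norm_radialDir hne) hmemS (norm_nonneg _)
              (t := min a (2 * m + k * m))
              (lt_min (by linarith) (by linarith [haT.2])) (min_le_right _ _)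
            rw [norm_smul_radialDir, Φ.apply_symm_apply] at hB
            exact hγ.2.2 a haT (hAB.monoB (le_min haT.1 (by positivity)) (min_le_left _ _) hB)
          · by_contra! hcon
            have : v ∈ S := ⟨⟨haS.1.1.trans hv.1.le, hv.2⟩, by
              rw [hnorm] at hcon
              simpa using hcon⟩
            exact (hamax this).not_gt hv.1
      have hmain := h.norm_radialDir_sub_le_add hmono hm hlam hF hγ.2.1 ha0 hau hu.2
        (fun v hv => by
          rw [mul_max_of_nonneg _ _ zero_le_two]
          refine max_le (by linarith [hfar v hv]) (hball hγ v ⟨by linarith [hv.1], ?_⟩)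
          exact hv.2.trans hu.2) e₀
      rw [hsymm, radialDir_smul he hs0] at hmain
      have hFu := mul_le_mul_of_nonneg_left (hFm (show u / 4 ≤ s / 2 by linarith [hu.2]))
        (show 0 ≤ 4 * lam by positivity)
      rcases hse with h1 | h1
      · linarith
      · simp only [hψ] at h1
        linarith
  obtain ⟨k, hk⟩ := exists_nat_ge (s / m)
  refine key k e he s hse hs ?_
  have := (div_le_iff₀ hm).mp hk
  linarith

/-- Proposition 3.2.  If the complete non-compact manifold
`M` is spherically symmetric about `p`, nonpositively curved, and
`I = ∫₁^∞ dr/G(r) < ∞`, then for every `λ > 1` there exists `L > 0` such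
that for every `q` with `d(p,q) > L` the set `B_∞` of the growth
competition between `p` and `q` is unbounded. -/
theorem coexistence_of_convergent_integral
    {M : Type*} [MetricSpace M] [ProperSpace M] [NoncompactSpace M] {n : ℕ}
    (p : M) (G : ℝ → ℝ) (Φ : Euc n ≃ M)
    (hsym : IsSphericallySymmetric p G Φ)
    (hnpc : NonposCurvWarping G) (hhyp : HyperbolicWarping G)
    (lam : ℝ) (hlam : 1 < lam) :
    ∃ L : ℝ, 0 < L ∧ ∀ q : M, L < dist p q →
      ∀ A B : ℝ → Set M, IsGrowthCompetition p q lam A B →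
        ¬ Bornology.IsBounded (Binfty B) := by
  have hpos : ∀ s, 0 < s → 0 < G s := hsym.1.1
  have hcont : ContinuousOn G (Ioi 0) := hsym.1.2.1.continuousOn
  have hmono : MonotoneOn G (Ioi 0) := by
    refine monotoneOn_of_deriv_nonneg (convex_Ioi 0) hcont ?_ ?_
    · rw [interior_Ioi]
      exact hsym.1.2.1.differentiableOn (by simp)
    · rw [interior_Ioi]
      exact fun x hx => zero_le_one.trans (hnpc.2 x hx)
  have hlam0 : 0 < lam := zero_lt_one.trans hlam
  obtain ⟨m₀, hm₀, hF⟩ := exists_small_primitive hpos hmono hcont hhyp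
    (ε := 1 / (4 * lam)) (by positivity)
  refine ⟨2 * m₀ * (lam + 2), by positivity, fun q hq A B hAB hbdd => ?_⟩
  obtain ⟨F, hFc, hF0, hFm, hFs, hFle⟩ := hF m₀ le_rfl
  have hq0 : Φ.symm q ≠ 0 := by
    intro h0
    have hpq : q = p := by rw [← hsym.2.1, ← h0, Φ.apply_symm_apply]
    rw [hpq, dist_self] at hq
    exact hq.not_ge (by positivity)
  set e : Euc n := -radialDir (Φ.symm q) with he_def
  have he : ‖e‖ = 1 := by rw [he_def, norm_neg, norm_radialDir hq0]
  have hshadow : ∀ s : ℝ, s ∈ ShadowRegion (2 * m₀) (fun r => 4 * lam * F (r / 2))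
      (radialDir (Φ.symm q)) e := by
    intro s
    refine Or.inr ?_
    have h1 : ‖e - radialDir (Φ.symm q)‖ = 2 := by
      rw [he_def, ← neg_add', norm_neg, ← two_smul ℝ, norm_smul, norm_radialDir hq0]
      simp
    have h2 := hFle (s / 2)
    rw [le_div_iff₀ (by positivity)] at h2
    simp only [h1]
    linarith
  have hmem : ∀ s : ℝ, 0 ≤ s → Φ (s • e) ∈ Binfty B := by
    intro s hs
    refine mem_iUnion₂.mpr ⟨s + 1, by simp only [mem_Ici]; linarith, ?_⟩
    exact hsym.smul_mem_B hAB he hs (lt_add_one s) fun v hv =>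
      hsym.notMem_A_of_shadow hmono hlam0 hAB hm₀ hFc hF0 hFm hFs hq.le he hv.1 (hshadow v)
  obtain ⟨C, hC⟩ := hbdd.subset_closedBall p
  have h1 := hC (hmem (|C| + 1) (by positivity))
  rw [mem_closedBall, hsym.2.2.1, norm_smul, he, mul_one, Real.norm_eq_abs,
    abs_of_nonneg (by positivity)] at h1
  linarith [le_abs_self C]

end GrowthComp
end
end
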